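/- arXiv:0807.2705 — 8 statements merged into one kernel-verified Lean document; each statement's English description precedes it below -/
import Mathlib

section
/- Let (X,d) be a finite metric space with cardinality n = |X| ≥ 2. Then the (normalized) 0-negative type gap of (X,d) satisfies Γ_X^0 = (1/2)(1/⌊n/2⌋ + 1/⌈n/2⌉). In particular Γ_X^0 > 0. -/
/-- Twice the sum of products over pairs `i < j` is the square of the sum minus the sum of squares. -/
lemma two_mul_sum_sum_lt_mul {ι : Type*} [Fintype ι] [LinearOrder ι] (m : ι → ℝ) :
    2 * (∑ i, ∑ j, if i < j then m i * m j else 0) = (∑ i, m i) ^ 2 - ∑ i, m i ^ 2 := by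
  have hswap : (∑ i, ∑ j, if i < j then m i * m j else 0)
      = ∑ i, ∑ j, if j < i then m i * m j else 0 := by
    rw [Finset.sum_comm]
    simp only [mul_comm]
  have hdiag : ∑ i, m i ^ 2 = ∑ i, ∑ j, if i = j then m i * m j else 0 := by
    simp [sq]
  rw [two_mul]
  nth_rewrite 2 [hswap]
  rw [eq_sub_iff_add_eq, hdiag, sq, Finset.sum_mul_sum]
  simp only [← Finset.sum_add_distrib]
  refine Finset.sum_congr rfl fun i _ => Finset.sum_congr rfl fun j _ => ?_
  rcases lt_trichotomy i j with h | h | h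
  · simp [h, h.not_gt, h.ne]
  · simp [h]
  · simp [h, h.not_gt, h.ne']

/-- For normalized loads the `0`-negative type simplex gap is half the sum of the squared loads. -/
lemma zero_simplex_gap_eq {ι κ : Type*} [Fintype ι] [LinearOrder ι] [Fintype κ] [LinearOrder κ]
    {m : ι → ℝ} {n : κ → ℝ} (hm : ∑ j, m j = 1) (hn : ∑ i, n i = 1) :
    (∑ j, ∑ i, m j * n i) - (∑ j₁, ∑ j₂, if j₁ < j₂ then m j₁ * m j₂ else 0)
      - (∑ i₁, ∑ i₂, if i₁ < i₂ then n i₁ * n i₂ else 0)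
      = 1 / 2 * (∑ j, m j ^ 2 + ∑ i, n i ^ 2) := by
  have h₁ := two_mul_sum_sum_lt_mul m
  have h₂ := two_mul_sum_sum_lt_mul n
  rw [hm] at h₁
  rw [hn] at h₂
  rw [← Finset.sum_mul_sum, hm, hn]
  linarith

lemma one_div_card_le_sum_sq {ι : Type*} [Fintype ι] {m : ι → ℝ} (hm : ∑ j, m j = 1) :
    1 / (Fintype.card ι : ℝ) ≤ ∑ j, m j ^ 2 := by
  have h := sq_sum_le_card_mul_sum_sq (s := Finset.univ) (f := m)
  rw [hm, Finset.card_univ, one_pow] at h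
  exact div_le_of_le_mul₀ (Nat.cast_nonneg _) (Finset.sum_nonneg fun j _ => sq_nonneg _)
    (by linarith)

/-- The chord of `x ↦ 1 / x` through the halves of `N` lies below it at every positive integer. -/
lemma chord_halves_le_one_div {N q : ℕ} (hN : 2 ≤ N) (hq : 0 < q) :
    1 / ((N / 2 : ℕ) : ℝ) + 1 / (((N + 1) / 2 : ℕ) : ℝ)
      - q / (((N / 2 : ℕ) : ℝ) * (((N + 1) / 2 : ℕ) : ℝ)) ≤ 1 / (q : ℝ) := by
  have hf : 0 < N / 2 := by omega
  have hfc : N / 2 ≤ (N + 1) / 2 ∧ (N + 1) / 2 ≤ N / 2 + 1 := by omega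
  generalize N / 2 = f at *
  generalize (N + 1) / 2 = c at *
  have hprod : (0 : ℝ) ≤ ((q : ℝ) - f) * (q - c) := by
    rcases le_or_gt q f with h | h
    · have h₁ : (q : ℝ) ≤ f := by exact_mod_cast h
      have h₂ : (q : ℝ) ≤ c := by exact_mod_cast h.trans hfc.1
      exact mul_nonneg_of_nonpos_of_nonpos (by linarith) (by linarith)
    · have h₁ : (f : ℝ) ≤ q := by exact_mod_cast h.le
      have h₂ : (c : ℝ) ≤ q := by exact_mod_cast hfc.2.trans h
      exact mul_nonneg (by linarith) (by linarith)
  have hq' : (0 : ℝ) < q := by exact_mod_cast hq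
  have hf' : (0 : ℝ) < f := by exact_mod_cast hf
  have hc' : (0 : ℝ) < c := by exact_mod_cast hf.trans_le hfc.1
  have key : 1 / (q : ℝ) - (1 / (f : ℝ) + 1 / (c : ℝ) - q / ((f : ℝ) * c))
      = ((q : ℝ) - f) * (q - c) / (q * f * c) := by
    field_simp
    ring
  rw [← sub_nonneg, key]
  positivity

lemma one_div_halves_add_le {N q t : ℕ} (hN : 2 ≤ N) (hq : 0 < q) (ht : 0 < t) (h : q + t ≤ N) :
    1 / ((N / 2 : ℕ) : ℝ) + 1 / (((N + 1) / 2 : ℕ) : ℝ) ≤ 1 / (q : ℝ) + 1 / (t : ℝ) := by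
  have h₁ := chord_halves_le_one_div hN hq
  have h₂ := chord_halves_le_one_div hN ht
  have hf : 0 < N / 2 := by omega
  have hc : 0 < (N + 1) / 2 := by omega
  have hs : q + t ≤ N / 2 + (N + 1) / 2 := by omega
  generalize N / 2 = f at *
  generalize (N + 1) / 2 = c at *
  have hf' : (0 : ℝ) < f := by exact_mod_cast hf
  have hc' : (0 : ℝ) < c := by exact_mod_cast hc
  have hs' : (q : ℝ) + t ≤ f + c := by exact_mod_cast hs
  have hle : ((q : ℝ) + t) / (f * c) ≤ (f + c) / (f * c) := by gcongr
  have heq : ((f : ℝ) + c) / (f * c) = 1 / f + 1 / c := by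
    field_simp
    ring
  rw [heq, add_div] at hle
  linarith

/-- Theorem 3.3: for a finite metric space `X` with `n = |X| ≥ 2`, the
(normalized) `0`-negative type gap — the infimum over all normalized `(q,t)`-simplices
`D(ω)` in `X` of the `0`-negative type simplex gap
`γ_D^0(ω) = Σ_{j,i} m_j n_i − Σ_{j₁<j₂} m_{j₁}m_{j₂} − Σ_{i₁<i₂} n_{i₁}n_{i₂}` —
equals `(1/2)(1/⌊n/2⌋ + 1/⌈n/2⌉)`; in particular it is positive. -/
theorem zero_negative_type_gap {X : Type*} [MetricSpace X] [Fintype X]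
    (hn : 2 ≤ Fintype.card X) :
    IsGLB {v : ℝ | ∃ (q t : ℕ) (_ : 0 < q) (_ : 0 < t)
        (a : Fin q → X) (b : Fin t → X) (_ : Function.Injective (Sum.elim a b))
        (m : Fin q → ℝ) (n : Fin t → ℝ),
        (∀ j, 0 < m j) ∧ (∀ i, 0 < n i) ∧ (∑ j, m j = 1) ∧ (∑ i, n i = 1) ∧
        v = (∑ j : Fin q, ∑ i : Fin t, m j * n i)
            - (∑ j₁ : Fin q, ∑ j₂ : Fin q, if j₁ < j₂ then m j₁ * m j₂ else 0)
            - (∑ i₁ : Fin t, ∑ i₂ : Fin t, if i₁ < i₂ then n i₁ * n i₂ else 0)}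
      (1 / 2 * (1 / ((Fintype.card X / 2 : ℕ) : ℝ)
        + 1 / (((Fintype.card X + 1) / 2 : ℕ) : ℝ))) ∧
    0 < 1 / 2 * (1 / ((Fintype.card X / 2 : ℕ) : ℝ)
        + 1 / (((Fintype.card X + 1) / 2 : ℕ) : ℝ)) := by
  have hf : 0 < Fintype.card X / 2 := by omega
  have hc : 0 < (Fintype.card X + 1) / 2 := by omega
  have hf' : (0 : ℝ) < (Fintype.card X / 2 : ℕ) := by exact_mod_cast hf
  have hc' : (0 : ℝ) < ((Fintype.card X + 1) / 2 : ℕ) := by exact_mod_cast hc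
  refine ⟨IsLeast.isGLB ⟨?_, ?_⟩, by positivity⟩
  · have hcard : Fintype.card X / 2 + (Fintype.card X + 1) / 2 = Fintype.card X := by omega
    let e : Fin (Fintype.card X / 2) ⊕ Fin ((Fintype.card X + 1) / 2) ≃ X :=
      finSumFinEquiv.trans ((finCongr hcard).trans (Fintype.equivFin X).symm)
    have hm : ∑ _j : Fin (Fintype.card X / 2), 1 / ((Fintype.card X / 2 : ℕ) : ℝ) = 1 := by
      rw [Finset.sum_const, Finset.card_univ, Fintype.card_fin, nsmul_eq_mul]
      exact mul_one_div_cancel hf'.ne'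
    have hn : ∑ _i : Fin ((Fintype.card X + 1) / 2),
        1 / (((Fintype.card X + 1) / 2 : ℕ) : ℝ) = 1 := by
      rw [Finset.sum_const, Finset.card_univ, Fintype.card_fin, nsmul_eq_mul]
      exact mul_one_div_cancel hc'.ne'
    refine ⟨_, _, hf, hc, e ∘ Sum.inl, e ∘ Sum.inr, ?_, _, _,
      fun _ => one_div_pos.2 hf', fun _ => one_div_pos.2 hc', hm, hn, ?_⟩
    · rw [Sum.elim_comp_inl_inr]
      exact e.injective
    · rw [zero_simplex_gap_eq hm hn]
      simp only [sq, ← Finset.mul_sum, hm, hn, mul_one]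
  · rintro v ⟨q, t, hq, ht, a, b, hab, m, n, -, -, hm, hn', rfl⟩
    have hqt : q + t ≤ Fintype.card X := by
      simpa using Fintype.card_le_of_injective _ hab
    have h₁ := one_div_card_le_sum_sq hm
    have h₂ := one_div_card_le_sum_sq hn'
    rw [Fintype.card_fin] at h₁ h₂
    have h₃ := one_div_halves_add_le hn hq ht hqt
    rw [zero_simplex_gap_eq hm hn']
    linarith
end

section
/- Let (X,d) be a finite metric space with cardinality n = |X| ≥ 3 such that d is not a positive multiple of the discrete metric, i.e. the scaled diameter 𝔇 = (diam X)/min{d(x,y) : x ≠ y} satisfies 𝔇 > 1. Set Γ = (1/2)(1/⌊n/2⌋ + 1/⌈n/2⌉) and ζ = ln(1/(1−Γ)) / ln 𝔇. Then (X,d) has p-negative type for every p with 0 ≤ p ≤ ζ. -/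
/-- Among pairs of positive integers with sum at most `n`, the sum of the reciprocals is least at the
balanced pair `(⌊n / 2⌋, ⌈n / 2⌉)`. -/
theorem inv_half_add_inv_half_le {n a b : ℕ} (ha : 0 < a) (hb : 0 < b) (hab : a + b ≤ n) :
    1 / ((n / 2 : ℕ) : ℝ) + 1 / (((n + 1) / 2 : ℕ) : ℝ) ≤ 1 / (a : ℝ) + 1 / (b : ℝ) := by
  obtain ⟨f, hf⟩ : ∃ f, f = n / 2 := ⟨_, rfl⟩
  obtain ⟨c, hc⟩ : ∃ c, c = (n + 1) / 2 := ⟨_, rfl⟩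
  obtain ⟨e, he⟩ : ∃ e, e = n - b := ⟨_, rfl⟩
  rw [← hf, ← hc]
  have hae : a ≤ e := by omega
  have hsum : e + b = f + c := by omega
  have hf0 : 0 < f := by omega
  have hc0 : 0 < c := by omega
  have he0 : 0 < e := by omega
  have hprod : e * b ≤ f * c := by
    rcases le_or_gt e f with h | h
    · obtain ⟨t, rfl⟩ := Nat.exists_eq_add_of_le h
      obtain rfl : b = t + c := by omega
      have : e ≤ c := by omega
      nlinarith
    · have hce : c ≤ e := by omega
      obtain ⟨t, rfl⟩ := Nat.exists_eq_add_of_le hce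
      obtain rfl : f = b + t := by omega
      have : b ≤ c := by omega
      nlinarith
  have hprod' : (e : ℝ) * b ≤ f * c := by exact_mod_cast hprod
  have hsum' : (e : ℝ) + b = f + c := by exact_mod_cast hsum
  have hae' : (a : ℝ) ≤ e := by exact_mod_cast hae
  have ha' : (0 : ℝ) < a := by exact_mod_cast ha
  have hb' : (0 : ℝ) < b := by exact_mod_cast hb
  have hf' : (0 : ℝ) < f := by exact_mod_cast hf0
  have hc' : (0 : ℝ) < c := by exact_mod_cast hc0
  have he' : (0 : ℝ) < e := by exact_mod_cast he0
  calc 1 / (f : ℝ) + 1 / (c : ℝ) = (f + c) / (f * c) := by field_simp; ring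
    _ ≤ (f + c) / (e * b) := by gcongr
    _ = 1 / (e : ℝ) + 1 / (b : ℝ) := by rw [← hsum']; field_simp; ring
    _ ≤ 1 / (a : ℝ) + 1 / (b : ℝ) := by gcongr

/-- A family of reals with zero sum has sum of squares at least `(S ^ 2) * (1 / ⌊n / 2⌋ + 1 / ⌈n / 2⌉)`,
where `S` is the sum of the positive parts. -/
theorem sq_sum_posPart_mul_le_sum_sq {ι : Type*} [Fintype ι] {n : ℕ} (hn : Fintype.card ι ≤ n)
    (η : ι → ℝ) (hη : ∑ i, η i = 0) :
    (∑ i, max (η i) 0) ^ 2 * (1 / ((n / 2 : ℕ) : ℝ) + 1 / (((n + 1) / 2 : ℕ) : ℝ)) ≤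
      ∑ i, η i ^ 2 := by
  classical
  set P := Finset.univ.filter fun i => 0 ≤ η i with hP
  set N := Finset.univ.filter fun i => ¬ 0 ≤ η i with hN
  set S := ∑ i, max (η i) 0 with hS
  have hcard : P.card + N.card ≤ n := by
    rw [Finset.card_filter_add_card_filter_not]; exact hn
  have hSP : S = ∑ i ∈ P, η i := by
    rw [hS, hP, Finset.sum_filter]
    refine Finset.sum_congr rfl fun i _ => ?_
    split_ifs with h
    · exact max_eq_left h
    · exact max_eq_right (not_le.mp h).le
  have hsplit : ∑ i ∈ P, η i + ∑ i ∈ N, η i = 0 := by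
    rw [Finset.sum_filter_add_sum_filter_not, hη]
  have hsq : ∑ i ∈ P, η i ^ 2 + ∑ i ∈ N, η i ^ 2 = ∑ i, η i ^ 2 :=
    Finset.sum_filter_add_sum_filter_not _ _ _
  by_cases h0 : S = 0
  · rw [h0]
    simpa using Finset.sum_nonneg fun i _ => sq_nonneg (η i)
  have hPpos : 0 < P.card := by
    rw [Finset.card_pos, Finset.nonempty_iff_ne_empty]
    intro h
    rw [h, Finset.sum_empty] at hSP
    exact h0 hSP
  have hNpos : 0 < N.card := by
    rw [Finset.card_pos, Finset.nonempty_iff_ne_empty]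
    intro h
    rw [h, Finset.sum_empty, ← hSP] at hsplit
    exact h0 (by linarith)
  have hCP : S ^ 2 / P.card ≤ ∑ i ∈ P, η i ^ 2 := by
    rw [div_le_iff₀' (by exact_mod_cast hPpos), hSP]
    exact sq_sum_le_card_mul_sum_sq
  have hCN : S ^ 2 / N.card ≤ ∑ i ∈ N, η i ^ 2 := by
    have : S ^ 2 = (∑ i ∈ N, η i) ^ 2 := by
      rw [hSP, eq_neg_of_add_eq_zero_left hsplit, neg_sq]
    rw [div_le_iff₀' (by exact_mod_cast hNpos), this]
    exact sq_sum_le_card_mul_sum_sq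
  calc S ^ 2 * (1 / ((n / 2 : ℕ) : ℝ) + 1 / (((n + 1) / 2 : ℕ) : ℝ))
      ≤ S ^ 2 * (1 / (P.card : ℝ) + 1 / (N.card : ℝ)) := by
        gcongr ?_ * ?_
        exact inv_half_add_inv_half_le hPpos hNpos hcard
    _ = S ^ 2 / P.card + S ^ 2 / N.card := by ring
    _ ≤ ∑ i, η i ^ 2 := by linarith

/-- An off-diagonal quadratic form whose coefficients lie in `[(1 - Γ) * M, M]` is nonpositive on
vectors with zero sum, where `Γ` is the mean of `1 / ⌊n / 2⌋` and `1 / ⌈n / 2⌉`. -/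
theorem sum_offDiag_mul_nonpos {ι : Type*} [Fintype ι] [DecidableEq ι] {n : ℕ}
    (hn : Fintype.card ι ≤ n) {M Γ : ℝ} (hM : 0 ≤ M)
    (hΓ : Γ = 1 / 2 * (1 / ((n / 2 : ℕ) : ℝ) + 1 / (((n + 1) / 2 : ℕ) : ℝ)))
    (A : ι → ι → ℝ) (hAle : ∀ i j, i ≠ j → A i j ≤ M)
    (hAge : ∀ i j, i ≠ j → (1 - Γ) * M ≤ A i j)
    (η : ι → ℝ) (hη : ∑ i, η i = 0) :
    ∑ i, ∑ j, (if i = j then 0 else A i j * (η i * η j)) ≤ 0 := by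
  set u : ι → ℝ := fun i => max (η i) 0 with hu
  set v : ι → ℝ := fun i => max (-η i) 0 with hv
  have hu0 : ∀ i, 0 ≤ u i := fun i => le_max_right _ _
  have hv0 : ∀ i, 0 ≤ v i := fun i => le_max_right _ _
  have huv : ∀ i, η i = u i - v i := fun i => (max_zero_sub_max_neg_zero_eq_self (η i)).symm
  have huv0 : ∀ i, u i * v i = 0 := by
    intro i
    rcases le_total 0 (η i) with h | h
    · simp [hv, h]
    · simp [hu, h]
  have hsum : ∑ i, v i = ∑ i, u i := by
    have : ∑ i, (u i - v i) = 0 := by rw [← hη]; exact Finset.sum_congr rfl fun i _ => (huv i).symm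
    rw [Finset.sum_sub_distrib] at this
    linarith
  have hterm : ∀ i j, (if i = j then 0 else A i j * (η i * η j)) ≤
      M * (u i * u j + v i * v j) - (1 - Γ) * M * (u i * v j + v i * u j)
        - (if i = j then M * η i ^ 2 else 0) := by
    intro i j
    split_ifs with h
    · subst h
      rw [huv i]
      have := huv0 i
      apply le_of_eq
      linear_combination (2 * (1 - Γ) * M - 2 * M) * this
    · rw [huv i, huv j]
      have h1 := mul_le_mul_of_nonneg_right (hAle i j h)
        (add_nonneg (mul_nonneg (hu0 i) (hu0 j)) (mul_nonneg (hv0 i) (hv0 j)))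
      have h2 := mul_le_mul_of_nonneg_right (hAge i j h)
        (add_nonneg (mul_nonneg (hu0 i) (hv0 j)) (mul_nonneg (hv0 i) (hu0 j)))
      linear_combination h1 + h2
  refine (Finset.sum_le_sum fun i _ => Finset.sum_le_sum fun j _ => hterm i j).trans ?_
  have hkey := mul_le_mul_of_nonneg_left (sq_sum_posPart_mul_le_sum_sq hn η hη) hM
  have heval : ∑ i, ∑ j, (M * (u i * u j + v i * v j) - (1 - Γ) * M * (u i * v j + v i * u j)
        - (if i = j then M * η i ^ 2 else 0)) =
      M * ((∑ i, u i) * (∑ i, u i) + (∑ i, v i) * (∑ i, v i))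
        - (1 - Γ) * M * ((∑ i, u i) * (∑ i, v i) + (∑ i, v i) * (∑ i, u i))
        - M * ∑ i, η i ^ 2 := by
    simp only [Finset.sum_sub_distrib, ← Finset.mul_sum, Finset.sum_add_distrib,
      Finset.sum_mul_sum, Finset.sum_ite_eq, Finset.mem_univ, if_true]
  rw [heval, hsum]
  rw [← hu] at hkey
  have hΓ2 : 1 / ((n / 2 : ℕ) : ℝ) + 1 / (((n + 1) / 2 : ℕ) : ℝ) = 2 * Γ := by rw [hΓ]; ring
  rw [hΓ2] at hkey
  linear_combination hkey

/-- The mean of `1 / ⌊n / 2⌋` and `1 / ⌈n / 2⌉` is less than one for `n ≥ 3`. -/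
theorem half_mul_inv_half_add_inv_half_lt_one {n : ℕ} (hn : 3 ≤ n) :
    1 / 2 * (1 / ((n / 2 : ℕ) : ℝ) + 1 / (((n + 1) / 2 : ℕ) : ℝ)) < 1 := by
  have h1 : (1 : ℝ) ≤ ((n / 2 : ℕ) : ℝ) := by exact_mod_cast (by omega : 1 ≤ n / 2)
  have h2 : (2 : ℝ) ≤ (((n + 1) / 2 : ℕ) : ℝ) := by exact_mod_cast (by omega : 2 ≤ (n + 1) / 2)
  have h3 := one_div_le_one_div_of_le one_pos h1
  have h4 := one_div_le_one_div_of_le two_pos h2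
  linarith

/-- Theorem 4.1, nonstrict part: a finite metric space `X` with
`n = |X| ≥ 3` and scaled diameter `𝔇 = (diam X)/min{d(x,y) : x ≠ y} > 1` has
`p`-negative type for every `0 ≤ p ≤ ζ`, where
`ζ = ln(1/(1−Γ))/ln 𝔇` and `Γ = (1/2)(1/⌊n/2⌋ + 1/⌈n/2⌉)`. -/
theorem negative_type_lower_bound {X : Type*} [MetricSpace X] [Fintype X]
    (hn : 3 ≤ Fintype.card X)
    (Dmax Dmin 𝔇 : ℝ)
    (hmax : IsGreatest {r : ℝ | ∃ x y : X, r = dist x y} Dmax)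
    (hmin : IsLeast {r : ℝ | ∃ x y : X, x ≠ y ∧ r = dist x y} Dmin)
    (h𝔇 : 𝔇 = Dmax / Dmin) (h𝔇1 : 1 < 𝔇)
    (Γ ζ : ℝ)
    (hΓ : Γ = 1 / 2 * (1 / ((Fintype.card X / 2 : ℕ) : ℝ)
        + 1 / (((Fintype.card X + 1) / 2 : ℕ) : ℝ)))
    (hζ : ζ = Real.log (1 / (1 - Γ)) / Real.log 𝔇)
    (p : ℝ) (hp0 : 0 ≤ p) (hpζ : p ≤ ζ) :
    ∀ (k : ℕ), 2 ≤ k → ∀ x : Fin k → X, Function.Injective x →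
      ∀ η : Fin k → ℝ, (∑ l, η l = 0) →
        ∑ i, ∑ j, (if i = j then 0 else dist (x i) (x j) ^ p * (η i * η j)) ≤ 0 := by
  intro k _ x hx η hη
  have hΓ1 : 0 < 1 - Γ := by
    have := half_mul_inv_half_add_inv_half_lt_one hn
    rw [← hΓ] at this
    linarith
  have hDmin : 0 < Dmin := by
    obtain ⟨a, b, hab, h⟩ := hmin.1
    rw [h]
    exact dist_pos.mpr hab
  have h𝔇0 : 0 < 𝔇 := one_pos.trans h𝔇1
  have hDmax : Dmax = 𝔇 * Dmin := by rw [h𝔇, div_mul_cancel₀ _ hDmin.ne']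
  have hpow : (1 - Γ) * 𝔇 ^ p ≤ 1 := by
    rw [hζ, le_div_iff₀ (Real.log_pos h𝔇1)] at hpζ
    have : 𝔇 ^ p ≤ 1 / (1 - Γ) := by
      rw [← Real.log_le_log_iff (Real.rpow_pos_of_pos h𝔇0 p) (one_div_pos.mpr hΓ1),
        Real.log_rpow h𝔇0]
      exact hpζ
    rwa [le_div_iff₀' hΓ1] at this
  have hbound : (1 - Γ) * Dmax ^ p ≤ Dmin ^ p := by
    rw [hDmax, Real.mul_rpow h𝔇0.le hDmin.le, ← mul_assoc]
    exact mul_le_of_le_one_left (Real.rpow_nonneg hDmin.le p) hpow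
  have hcard : Fintype.card (Fin k) ≤ Fintype.card X := Fintype.card_le_of_injective x hx
  refine sum_offDiag_mul_nonpos hcard (M := Dmax ^ p)
    (Real.rpow_nonneg (hDmax ▸ (mul_pos h𝔇0 hDmin).le) p) hΓ
    (fun i j => dist (x i) (x j) ^ p) (fun i j _ => ?_) (fun i j hij => ?_) η hη
  · exact Real.rpow_le_rpow dist_nonneg (hmax.2 ⟨x i, x j, rfl⟩) hp0
  · exact hbound.trans
      (Real.rpow_le_rpow hDmin.le (hmin.2 ⟨x i, x j, hx.ne hij, rfl⟩) hp0)
end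

section
/- Let (X,d) be a finite metric space with cardinality n = |X| ≥ 3 such that d is not a positive multiple of the discrete metric, i.e. the scaled diameter 𝔇 = (diam X)/min{d(x,y) : x ≠ y} satisfies 𝔇 > 1. Set Γ = (1/2)(1/⌊n/2⌋ + 1/⌈n/2⌉) and ζ = ln(1/(1−Γ)) / ln 𝔇. Then (X,d) has strict p-negative type for every p with 0 ≤ p < ζ: for every integer k ≥ 2, every choice of k distinct points x_1,…,x_k ∈ X, and all real numbers η_1,…,η_k with η_1+⋯+η_k = 0 and (η_1,…,η_k) ≠ (0,…,0), one has Σ_{1≤i,j≤k} d(x_i,x_j)^p η_i η_j < 0. -/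
open Finset in
/-- If the off-diagonal weights lie in `[m, M]`, a nonzero vector with vanishing sum makes the
associated quadratic form negative as soon as `M * (1 - γ) < m`, where `2 * γ` bounds `1/s + 1/t`
from below over all positive `s`, `t` with `s + t` the number of indices. -/
theorem sum_offDiag_weight_mul_neg {ι : Type*} [Fintype ι] [DecidableEq ι]
    {w : ι → ι → ℝ} {m M γ : ℝ} (hM : 0 ≤ M)
    (hw : ∀ i j, i ≠ j → m ≤ w i j ∧ w i j ≤ M) (hγ : M * (1 - γ) < m)
    (hst : ∀ s t : ℕ, 0 < s → 0 < t → s + t = Fintype.card ι →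
      2 * γ ≤ 1 / (s : ℝ) + 1 / (t : ℝ))
    {η : ι → ℝ} (hη : ∑ i, η i = 0) (hη0 : η ≠ 0) :
    ∑ i, ∑ j, (if i = j then 0 else w i j * (η i * η j)) < 0 := by
  set a : ι → ℝ := fun i => max (η i) 0 with ha
  set b : ι → ℝ := fun i => max (-η i) 0 with hb
  have ha0 : ∀ i, 0 ≤ a i := fun i => le_max_right _ _
  have hb0 : ∀ i, 0 ≤ b i := fun i => le_max_right _ _
  have hab : ∀ i, η i = a i - b i := by
    intro i
    rcases le_total (η i) 0 with h | h <;> simp [ha, hb, h]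
  have hab0 : ∀ i, a i * b i = 0 := by
    intro i
    rcases le_total (η i) 0 with h | h <;> simp [ha, hb, h]
  have hsum : ∑ i, b i = ∑ i, a i := by
    have h : ∑ i, (a i - b i) = 0 := by rw [← hη]; exact sum_congr rfl fun i _ => (hab i).symm
    rw [sum_sub_distrib] at h
    linarith
  set A : ℝ := ∑ i, a i with hA
  have hApos : 0 < A := by
    rcases (sum_nonneg fun i _ => ha0 i : 0 ≤ A).lt_or_eq with h | h
    · exact h
    · refine absurd (funext fun i => ?_) hη0
      have h1 := (sum_eq_zero_iff_of_nonneg fun i _ => ha0 i).1 h.symm i (mem_univ i)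
      have h2 := (sum_eq_zero_iff_of_nonneg fun i _ => hb0 i).1 (hsum.trans h.symm) i (mem_univ i)
      rw [hab, h1, h2]
      simp
  set P : Finset ι := univ.filter fun i => 0 < η i with hP
  have hbP : ∀ i ∉ Pᶜ, b i = 0 := by
    intro i hi
    have h : 0 < η i := by simpa [hP] using hi
    simp [hb, h.le]
  have haP : ∀ i ∉ P, a i = 0 := by
    intro i hi
    have h : η i ≤ 0 := by simpa [hP] using hi
    simp [ha, h]
  have restrict : ∀ (Q : Finset ι) (c : ι → ℝ), (∀ i ∉ Q, c i = 0) → ∑ i, c i = A →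
      0 < Q.card ∧ A ^ 2 * (1 / (Q.card : ℝ)) ≤ ∑ i, c i ^ 2 := by
    intro Q c hc hcA
    have h1 : ∑ i ∈ Q, c i = A :=
      hcA ▸ sum_subset (subset_univ Q) fun i _ hi => hc i hi
    have h2 : ∑ i ∈ Q, c i ^ 2 = ∑ i, c i ^ 2 :=
      sum_subset (subset_univ Q) fun i _ hi => by simp [hc i hi]
    have hQ : 0 < Q.card := by
      rw [card_pos]
      by_contra h
      rw [not_nonempty_iff_eq_empty] at h
      rw [h, sum_empty] at h1
      exact hApos.ne h1
    have h3 := sq_sum_le_card_mul_sum_sq (s := Q) (f := c)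
    rw [h1, h2] at h3
    refine ⟨hQ, ?_⟩
    rw [mul_one_div, div_le_iff₀ (by exact_mod_cast hQ)]
    linarith
  obtain ⟨hs, hsqa⟩ := restrict P a haP rfl
  obtain ⟨ht, hsqb⟩ := restrict Pᶜ b hbP hsum
  have hcard := hst _ _ hs ht (card_add_card_compl P)
  have hterm : ∀ i j, (if i = j then 0 else w i j * (η i * η j)) ≤
      (M * (a i * a j + b i * b j) - m * (a i * b j + b i * a j)) -
        (if i = j then M * (a i ^ 2 + b i ^ 2) else 0) := by
    intro i j
    split_ifs with h
    · subst h
      have := hab0 i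
      rw [mul_comm (b i) (a i), this]
      apply le_of_eq
      ring
    · obtain ⟨h1, h2⟩ := hw i j h
      rw [hab i, hab j]
      have h3 := mul_nonneg (sub_nonneg.2 h2)
        (add_nonneg (mul_nonneg (ha0 i) (ha0 j)) (mul_nonneg (hb0 i) (hb0 j)))
      have h4 := mul_nonneg (sub_nonneg.2 h1)
        (add_nonneg (mul_nonneg (ha0 i) (hb0 j)) (mul_nonneg (hb0 i) (ha0 j)))
      linarith
  calc _ ≤ ∑ i, ∑ j, ((M * (a i * a j + b i * b j) - m * (a i * b j + b i * a j)) -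
        (if i = j then M * (a i ^ 2 + b i ^ 2) else 0)) :=
        sum_le_sum fun i _ => sum_le_sum fun j _ => hterm i j
    _ = 2 * A ^ 2 * (M - m) - M * (∑ i, a i ^ 2 + ∑ i, b i ^ 2) := by
        simp only [sum_sub_distrib, ← mul_sum, sum_add_distrib, sum_ite_eq, mem_univ, if_true,
          ← sum_mul, hsum, ← hA]
        ring
    _ ≤ 2 * A ^ 2 * (M - m) - M * (A ^ 2 * (2 * γ)) := by
        have h1 := mul_le_mul_of_nonneg_left hcard (sq_nonneg A)
        have h2 : A ^ 2 * (2 * γ) ≤ ∑ i, a i ^ 2 + ∑ i, b i ^ 2 := by linarith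
        have h3 := mul_le_mul_of_nonneg_left h2 hM
        linarith
    _ < 0 := by
        have h := mul_pos (pow_pos hApos 2) (sub_pos.2 hγ)
        linarith

/-- Among splittings of at most `n` into two positive parts, `1/s + 1/t` is smallest for the
balanced splitting of `n`. -/
theorem one_div_half_add_one_div_half_le {n s t : ℕ} (hs : 0 < s) (ht : 0 < t)
    (hst : s + t ≤ n) :
    1 / ((n / 2 : ℕ) : ℝ) + 1 / (((n + 1) / 2 : ℕ) : ℝ) ≤ 1 / (s : ℝ) + 1 / (t : ℝ) := by
  obtain ⟨u, hu⟩ := Nat.exists_eq_add_of_le hst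
  have hle : 1 / ((t + u : ℕ) : ℝ) ≤ 1 / (t : ℝ) :=
    one_div_le_one_div_of_le (by exact_mod_cast ht) (by exact_mod_cast Nat.le_add_right t u)
  refine le_trans ?_ (add_le_add le_rfl hle)
  have hv : 0 < t + u := by omega
  have hsv : s + (t + u) = n := by omega
  generalize t + u = v at hv hsv
  have hq : 0 < n / 2 := by omega
  have hr : 0 < (n + 1) / 2 := by omega
  have hqr : n / 2 + (n + 1) / 2 = n := by omega
  have hbal : (n + 1) / 2 = n / 2 ∨ (n + 1) / 2 = n / 2 + 1 := by omega
  generalize n / 2 = q at hq hqr hbal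
  generalize (n + 1) / 2 = r at hr hqr hbal
  have hprod : s * v ≤ q * r := by
    have hsv' : s + v = q + r := by omega
    rcases hbal with rfl | rfl
    · nlinarith [sq_nonneg ((s : ℤ) - v)]
    · rcases le_or_gt s q with h | h
      · obtain ⟨e, rfl⟩ := Nat.exists_eq_add_of_le h
        obtain rfl : v = s + 2 * e + 1 := by omega
        nlinarith
      · obtain ⟨e, rfl⟩ := Nat.exists_eq_add_of_lt h
        obtain rfl : q = v + e := by omega
        nlinarith
  have hS : (0 : ℝ) < s := by exact_mod_cast hs
  have hV : (0 : ℝ) < v := by exact_mod_cast hv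
  have hQ : (0 : ℝ) < q := by exact_mod_cast hq
  have hR : (0 : ℝ) < r := by exact_mod_cast hr
  have hadd : (q : ℝ) + r = s + v := by exact_mod_cast hqr.trans hsv.symm
  have hprod' : (s : ℝ) * v ≤ q * r := by exact_mod_cast hprod
  rw [one_div_add_one_div hQ.ne' hR.ne', one_div_add_one_div hS.ne' hV.ne', hadd]
  exact div_le_div_of_nonneg_left (by positivity) (by positivity) hprod'

/-- Theorem 4.1, strict part: a finite metric space `X` with
`n = |X| ≥ 3` and scaled diameter `𝔇 = (diam X)/min{d(x,y) : x ≠ y} > 1` has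
strict `p`-negative type for every `0 ≤ p < ζ`, where
`ζ = ln(1/(1−Γ))/ln 𝔇` and `Γ = (1/2)(1/⌊n/2⌋ + 1/⌈n/2⌉)`. -/
theorem strict_negative_type_lower_bound {X : Type*} [MetricSpace X] [Fintype X]
    (hn : 3 ≤ Fintype.card X)
    (Dmax Dmin 𝔇 : ℝ)
    (hmax : IsGreatest {r : ℝ | ∃ x y : X, r = dist x y} Dmax)
    (hmin : IsLeast {r : ℝ | ∃ x y : X, x ≠ y ∧ r = dist x y} Dmin)
    (h𝔇 : 𝔇 = Dmax / Dmin) (h𝔇1 : 1 < 𝔇)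
    (Γ ζ : ℝ)
    (hΓ : Γ = 1 / 2 * (1 / ((Fintype.card X / 2 : ℕ) : ℝ)
        + 1 / (((Fintype.card X + 1) / 2 : ℕ) : ℝ)))
    (hζ : ζ = Real.log (1 / (1 - Γ)) / Real.log 𝔇)
    (p : ℝ) (hp0 : 0 ≤ p) (hpζ : p < ζ) :
    ∀ (k : ℕ), 2 ≤ k → ∀ x : Fin k → X, Function.Injective x →
      ∀ η : Fin k → ℝ, (∑ l, η l = 0) → η ≠ 0 →
        ∑ i, ∑ j, (if i = j then 0 else dist (x i) (x j) ^ p * (η i * η j)) < 0 := by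
  intro k _ x hx η hη hη0
  obtain ⟨u, v, huv, hDmin⟩ := hmin.1
  have hDmin0 : 0 < Dmin := hDmin ▸ dist_pos.2 huv
  have hDmax0 : 0 < Dmax := by
    have h : 0 < Dmax / Dmin := h𝔇 ▸ one_pos.trans h𝔇1
    exact (div_pos_iff_of_pos_right hDmin0).1 h
  have hΓ1 : Γ < 1 := by
    have h1 : (1 : ℝ) ≤ ((Fintype.card X / 2 : ℕ) : ℝ) := by
      exact_mod_cast (by omega : 1 ≤ Fintype.card X / 2)
    have h2 : (2 : ℝ) ≤ (((Fintype.card X + 1) / 2 : ℕ) : ℝ) := by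
      exact_mod_cast (by omega : 2 ≤ (Fintype.card X + 1) / 2)
    have h3 := one_div_le_one_div_of_le one_pos h1
    have h4 := one_div_le_one_div_of_le two_pos h2
    rw [hΓ]
    linarith
  have h1Γ : 0 < 1 - Γ := sub_pos.2 hΓ1
  have hpow : Dmax ^ p * (1 - Γ) < Dmin ^ p := by
    have h𝔇0 : 0 < 𝔇 := one_pos.trans h𝔇1
    have h1 : 𝔇 ^ p < 1 / (1 - Γ) := by
      rw [← Real.log_lt_log_iff (Real.rpow_pos_of_pos h𝔇0 p) (one_div_pos.2 h1Γ),
        Real.log_rpow h𝔇0]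
      rwa [hζ, lt_div_iff₀ (Real.log_pos h𝔇1)] at hpζ
    rw [h𝔇, Real.div_rpow hDmax0.le hDmin0.le,
      div_lt_div_iff₀ (Real.rpow_pos_of_pos hDmin0 p) h1Γ, one_mul] at h1
    exact h1
  refine sum_offDiag_weight_mul_neg (w := fun i j => dist (x i) (x j) ^ p)
    (Real.rpow_nonneg hDmax0.le p) (fun i j hij => ⟨?_, ?_⟩) hpow (fun s t hs ht hst => ?_) hη hη0
  · exact Real.rpow_le_rpow hDmin0.le (hmin.2 ⟨x i, x j, hx.ne hij, rfl⟩) hp0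
  · exact Real.rpow_le_rpow dist_nonneg (hmax.2 ⟨x i, x j, rfl⟩) hp0
  · have hk := one_div_half_add_one_div_half_le hs ht
      (hst.le.trans (Fintype.card_le_of_injective x hx))
    rw [hΓ]
    linarith
end

section
/- Let (X,d) be a finite metric space with n = |X| ≥ 3 points, with min{d(x,y) : x ≠ y} = 1 and diameter 𝔇 = diam X. Set Γ = (1/2)(1/⌊n/2⌋ + 1/⌈n/2⌉). Then for every normalized (q,t)-simplex D(ω) = [a_j(m_j); b_i(n_i)]_{q,t} in X and every p ≥ 0, the p-negative type simplex gap satisfies γ_D^p(ω) ≥ Γ − (1−Γ)(𝔇^p − 1). -/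
/-- The pairwise products of distinct weights summing to `1` add up to at most `(1 - 1 / k) / 2`. -/
lemma sum_lt_mul_le_of_sum_eq_one {k : ℕ} (w : Fin k → ℝ) (hw : ∑ j, w j = 1) :
    (∑ i, ∑ j, if i < j then w i * w j else 0) ≤ (1 - 1 / (k : ℝ)) / 2 := by
  have hswap : (∑ i, ∑ j, if j < i then w i * w j else 0)
      = ∑ i, ∑ j, if i < j then w i * w j else 0 := by
    rw [Finset.sum_comm]
    simp only [mul_comm]
  have hsplit : (∑ i, ∑ j, w i * w j) = (∑ i, ∑ j, if i < j then w i * w j else 0)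
      + (∑ i, ∑ j, if j < i then w i * w j else 0) + ∑ i, w i ^ 2 := by
    have hdiag : ∑ i, w i ^ 2 = ∑ i, ∑ j, if i = j then w i * w j else 0 := by
      simp [sq]
    rw [hdiag]
    simp only [← Finset.sum_add_distrib]
    refine Finset.sum_congr rfl fun i _ => Finset.sum_congr rfl fun j _ => ?_
    rcases lt_trichotomy i j with h | h | h
    · simp [h, h.not_gt, h.ne]
    · simp [h]
    · simp [h, h.not_gt, h.ne']
  have htotal : (∑ i, ∑ j, w i * w j) = 1 := by
    rw [← Finset.sum_mul_sum, hw, one_mul]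
  have hsq : 1 / (k : ℝ) ≤ ∑ i, w i ^ 2 := by
    have h := sq_sum_le_card_mul_sum_sq (s := Finset.univ) (f := w)
    rw [hw, Finset.card_univ, Fintype.card_fin, one_pow] at h
    exact div_le_of_le_mul₀ (Nat.cast_nonneg k) (Finset.sum_nonneg fun i _ => sq_nonneg _)
      (by linarith)
  linarith

/-- Weighted form of `sum_lt_mul_le_of_sum_eq_one` with coefficients bounded by `C`. -/
lemma sum_lt_mul_mul_le {k : ℕ} (w : Fin k → ℝ) (hw0 : ∀ j, 0 < w j) (hw : ∑ j, w j = 1)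
    (c : Fin k → Fin k → ℝ) (C : ℝ) (hC : 0 ≤ C) (hc : ∀ i j, c i j ≤ C) :
    (∑ i, ∑ j, if i < j then w i * w j * c i j else 0) ≤ C * ((1 - 1 / (k : ℝ)) / 2) := by
  refine le_trans ?_ (mul_le_mul_of_nonneg_left (sum_lt_mul_le_of_sum_eq_one w hw) hC)
  simp only [Finset.mul_sum]
  refine Finset.sum_le_sum fun i _ => Finset.sum_le_sum fun j _ => ?_
  split_ifs
  · rw [mul_comm C]
    exact mul_le_mul_of_nonneg_left (hc i j) (mul_pos (hw0 i) (hw0 j)).le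
  · simp

/-- On positive integers, `1 / q` lies above the chord of `x ↦ 1 / x` through `k` and `k + 1`. -/
lemma chord_le_one_div {q k : ℕ} (hq : 0 < q) (hk : 0 < k) :
    (2 * (k : ℝ) + 1 - q) / (k * (k + 1)) ≤ 1 / (q : ℝ) := by
  have hq' : (0 : ℝ) < q := by exact_mod_cast hq
  have hk' : (0 : ℝ) < k := by exact_mod_cast hk
  rw [div_le_div_iff₀ (by positivity) hq']
  rcases Nat.lt_or_ge k q with h | h
  · have h' : (k : ℝ) + 1 ≤ q := by exact_mod_cast h
    nlinarith
  · have h' : (q : ℝ) ≤ k := by exact_mod_cast h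
    nlinarith

/-- Among positive integers with `q + t ≤ N`, the balanced pair minimizes `1 / q + 1 / t`. -/
lemma balanced_le_one_div_add_one_div {q t N : ℕ} (hq : 0 < q) (ht : 0 < t) (h : q + t ≤ N) :
    1 / ((N / 2 : ℕ) : ℝ) + 1 / (((N + 1) / 2 : ℕ) : ℝ) ≤ 1 / (q : ℝ) + 1 / (t : ℝ) := by
  obtain ⟨k, hk⟩ : ∃ k, k = N / 2 := ⟨_, rfl⟩
  have hk0 : 0 < k := by omega
  have hk' : (0 : ℝ) < k := by exact_mod_cast hk0
  have hsum : (4 * (k : ℝ) + 2 - (q + t)) / (k * (k + 1)) ≤ 1 / (q : ℝ) + 1 / (t : ℝ) := by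
    refine le_trans (le_of_eq ?_) (add_le_add (chord_le_one_div hq hk0) (chord_le_one_div ht hk0))
    ring
  refine le_trans ?_ hsum
  rw [← hk]
  rcases Nat.mod_two_eq_zero_or_one N with hN | hN
  · have hN' : (N + 1) / 2 = k := by omega
    have hle : (q : ℝ) + t ≤ 2 * k := by exact_mod_cast (by omega : q + t ≤ 2 * k)
    rw [hN', ← add_div, div_le_div_iff₀ hk' (by positivity)]
    nlinarith
  · have hN' : (N + 1) / 2 = k + 1 := by omega
    have hle : (q : ℝ) + t ≤ 2 * k + 1 := by exact_mod_cast (by omega : q + t ≤ 2 * k + 1)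
    rw [hN', Nat.cast_add, Nat.cast_one, div_add_div _ _ hk'.ne' (by positivity)]
    gcongr
    linarith

/-- for a finite metric space `X` with `n = |X| ≥ 3`, minimal nonzero
distance `1` and diameter `𝔇`, every normalized `(q,t)`-simplex in `X` and every `p ≥ 0`
satisfy `γ_D^p(ω) ≥ Γ − (1 − Γ)(𝔇^p − 1)` where `Γ = (1/2)(1/⌊n/2⌋ + 1/⌈n/2⌉)`. -/
theorem simplex_gap_lower_bound {X : Type*} [MetricSpace X] [Fintype X]
    (hn : 3 ≤ Fintype.card X)
    (𝔇 : ℝ)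
    (hmin : IsLeast {r : ℝ | ∃ x y : X, x ≠ y ∧ r = dist x y} 1)
    (hmax : IsGreatest {r : ℝ | ∃ x y : X, r = dist x y} 𝔇)
    (Γ : ℝ)
    (hΓ : Γ = 1 / 2 * (1 / ((Fintype.card X / 2 : ℕ) : ℝ)
        + 1 / (((Fintype.card X + 1) / 2 : ℕ) : ℝ)))
    (q t : ℕ) (hq : 0 < q) (ht : 0 < t)
    (a : Fin q → X) (b : Fin t → X) (hab : Function.Injective (Sum.elim a b))
    (m : Fin q → ℝ) (n : Fin t → ℝ)
    (hm : ∀ j, 0 < m j) (hn' : ∀ i, 0 < n i)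
    (hms : ∑ j, m j = 1) (hns : ∑ i, n i = 1)
    (p : ℝ) (hp : 0 ≤ p) :
    Γ - (1 - Γ) * (𝔇 ^ p - 1) ≤
      (∑ j : Fin q, ∑ i : Fin t, m j * n i * dist (a j) (b i) ^ p)
      - (∑ j₁ : Fin q, ∑ j₂ : Fin q,
          if j₁ < j₂ then m j₁ * m j₂ * dist (a j₁) (a j₂) ^ p else 0)
      - (∑ i₁ : Fin t, ∑ i₂ : Fin t,
          if i₁ < i₂ then n i₁ * n i₂ * dist (b i₁) (b i₂) ^ p else 0) := by
  have hD : ∀ x y : X, dist x y ≤ 𝔇 := fun x y => hmax.2 ⟨x, y, rfl⟩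
  have hpow : ∀ x y : X, dist x y ^ p ≤ 𝔇 ^ p := fun x y =>
    Real.rpow_le_rpow dist_nonneg (hD x y) hp
  have hDp : 0 ≤ 𝔇 ^ p :=
    (Real.rpow_nonneg dist_nonneg p).trans (hpow (a ⟨0, hq⟩) (a ⟨0, hq⟩))
  have hA := sum_lt_mul_mul_le m hm hms (fun i j => dist (a i) (a j) ^ p) _ hDp
    fun i j => hpow _ _
  have hB := sum_lt_mul_mul_le n hn' hns (fun i j => dist (b i) (b j) ^ p) _ hDp
    fun i j => hpow _ _
  have hR : 1 ≤ ∑ j : Fin q, ∑ i : Fin t, m j * n i * dist (a j) (b i) ^ p := by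
    have h1 : (1 : ℝ) = ∑ j : Fin q, ∑ i : Fin t, m j * n i := by
      rw [← Finset.sum_mul_sum, hms, hns, one_mul]
    rw [h1]
    refine Finset.sum_le_sum fun j _ => Finset.sum_le_sum fun i _ => ?_
    have hne : a j ≠ b i := fun h => by
      simpa using @hab (Sum.inl j) (Sum.inr i) h
    exact le_mul_of_one_le_right (mul_pos (hm j) (hn' i)).le
      (Real.one_le_rpow (hmin.2 ⟨_, _, hne, rfl⟩) hp)
  have hcard : q + t ≤ Fintype.card X := by
    simpa using Fintype.card_le_of_injective _ hab
  have hG : 2 * Γ ≤ 1 / (q : ℝ) + 1 / (t : ℝ) := by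
    have := balanced_le_one_div_add_one_div hq ht hcard
    linarith
  have hmul := mul_le_mul_of_nonneg_left hG hDp
  linarith
end

section
/- Let n ≥ 3 be an integer, q = ⌊n/2⌋, t = ⌈n/2⌉, and let X = {a_1,…,a_q,b_1,…,b_t} be an n-point set with d(a_j,b_i) = 1 for all i,j, d(a_{j_1},a_{j_2}) = 2 for all j_1 ≠ j_2, d(b_{i_1},b_{i_2}) = 2 for all i_1 ≠ i_2, and d(x,x) = 0. Then d is a metric on X, and (X,d) has p-negative type if and only if 0 ≤ p ≤ ζ(n,2), where ζ(n,2) = ln(1/(1−Γ))/ln 2 and Γ = (1/2)(1/⌊n/2⌋ + 1/⌈n/2⌉). In particular, the maximal p-negative type of (X,d) is exactly ζ(n,2). -/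
/-- The distance function of the complete bipartite example: parts `Fin q` and `Fin t`,
distance `1` across the parts and `c` within each part. -/
def bipartiteDist (q t : ℕ) (c : ℝ) : Fin q ⊕ Fin t → Fin q ⊕ Fin t → ℝ := fun x y =>
  if x = y then 0 else
    match x, y with
    | Sum.inl _, Sum.inr _ => 1
    | Sum.inr _, Sum.inl _ => 1
    | Sum.inl _, Sum.inl _ => c
    | Sum.inr _, Sum.inr _ => c

/-- A sum along an injective family equals the sum over the whole type of its extension by zero. -/
theorem sum_comp_injective_eq_sum_extend {ι Y : Type*} [Fintype ι] [Fintype Y]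
    {x : ι → Y} (hx : Function.Injective x) (η : ι → ℝ) (F : Y → ℝ → ℝ) (hF : ∀ y, F y 0 = 0) :
    ∑ i, F (x i) (η i) = ∑ y, F y (Function.extend x η 0 y) := by
  refine Fintype.sum_of_injective x hx _ _ (fun y hy => ?_) (fun i => ?_)
  · rw [Function.extend_apply' _ _ _ (by simpa using hy), Pi.zero_apply, hF]
  · rw [hx.extend_apply]

theorem offDiag_sum_eq_sum_extend {ι Y : Type*} [Fintype ι] [DecidableEq ι] [Fintype Y]
    [DecidableEq Y] {x : ι → Y} (hx : Function.Injective x) (η : ι → ℝ) (w : Y → Y → ℝ) :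
    ∑ i, ∑ j, (if i = j then 0 else w (x i) (x j) * (η i * η j)) =
      ∑ u, ∑ v, (if u = v then 0 else
        w u v * (Function.extend x η 0 u * Function.extend x η 0 v)) := by
  rw [← sum_comp_injective_eq_sum_extend hx η
    (fun u a => ∑ v, if u = v then 0 else w u v * (a * Function.extend x η 0 v)) (by simp)]
  refine Finset.sum_congr rfl fun i _ => ?_
  rw [← sum_comp_injective_eq_sum_extend hx η
    (fun v b => if x i = v then 0 else w (x i) v * (η i * b)) (by simp)]
  simp only [hx.eq_iff]

theorem bipartiteDist_self (q t : ℕ) (c : ℝ) (x : Fin q ⊕ Fin t) :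
    bipartiteDist q t c x x = 0 := by
  simp [bipartiteDist]

theorem bipartiteDist_comm (q t : ℕ) (c : ℝ) (x y : Fin q ⊕ Fin t) :
    bipartiteDist q t c x y = bipartiteDist q t c y x := by
  rcases x with i | i <;> rcases y with j | j <;> simp [bipartiteDist, eq_comm]

theorem bipartiteDist_pos (q t : ℕ) {c : ℝ} (hc : 0 < c) {x y : Fin q ⊕ Fin t} (hxy : x ≠ y) :
    0 < bipartiteDist q t c x y := by
  rcases x with i | i <;> rcases y with j | j <;> simp_all [bipartiteDist]

theorem bipartiteDist_triangle (q t : ℕ) {c : ℝ} (hc : 1 ≤ c) (hc' : c ≤ 2)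
    (x y z : Fin q ⊕ Fin t) :
    bipartiteDist q t c x z ≤ bipartiteDist q t c x y + bipartiteDist q t c y z := by
  rcases x with i | i <;> rcases y with j | j <;> rcases z with k | k <;>
    simp only [bipartiteDist, Sum.inl.injEq, Sum.inr.injEq, reduceCtorEq, if_false] <;>
    split_ifs <;> first | linarith | (exfalso; simp_all)

theorem offDiag_sum_const_mul {ι : Type*} [Fintype ι] [DecidableEq ι] (C : ℝ) (a : ι → ℝ) :
    ∑ i, ∑ j, (if i = j then 0 else C * (a i * a j)) = C * ((∑ i, a i) ^ 2 - ∑ i, a i ^ 2) := by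
  have h : ∀ i j, (if i = j then 0 else C * (a i * a j)) =
      C * (a i * a j) - if i = j then C * a i ^ 2 else 0 := by
    intro i j
    split_ifs with hij
    · subst hij; ring
    · ring
  simp only [h, Finset.sum_sub_distrib, Finset.sum_ite_eq, Finset.mem_univ, if_true,
    ← Finset.mul_sum, ← Finset.sum_mul]
  ring

/-- The quadratic form of the `p`-th power of the bipartite distance. -/
theorem bipartiteDist_form (q t : ℕ) (c p : ℝ) (f : Fin q ⊕ Fin t → ℝ) :
    ∑ u, ∑ v, (if u = v then 0 else bipartiteDist q t c u v ^ p * (f u * f v)) =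
      c ^ p * ((∑ i, f (Sum.inl i)) ^ 2 - ∑ i, f (Sum.inl i) ^ 2) +
      c ^ p * ((∑ j, f (Sum.inr j)) ^ 2 - ∑ j, f (Sum.inr j) ^ 2) +
      2 * ((∑ i, f (Sum.inl i)) * ∑ j, f (Sum.inr j)) := by
  have hl : ∀ i j : Fin q, (if (Sum.inl i : Fin q ⊕ Fin t) = Sum.inl j then 0 else
      bipartiteDist q t c (Sum.inl i) (Sum.inl j) ^ p * (f (Sum.inl i) * f (Sum.inl j))) =
      if i = j then 0 else c ^ p * (f (Sum.inl i) * f (Sum.inl j)) := by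
    intro i j
    by_cases h : i = j <;> simp [bipartiteDist, h]
  have hr : ∀ i j : Fin t, (if (Sum.inr i : Fin q ⊕ Fin t) = Sum.inr j then 0 else
      bipartiteDist q t c (Sum.inr i) (Sum.inr j) ^ p * (f (Sum.inr i) * f (Sum.inr j))) =
      if i = j then 0 else c ^ p * (f (Sum.inr i) * f (Sum.inr j)) := by
    intro i j
    by_cases h : i = j <;> simp [bipartiteDist, h]
  simp only [Fintype.sum_sum_type, Finset.sum_add_distrib, hl, hr, offDiag_sum_const_mul]
  simp only [bipartiteDist, reduceCtorEq, if_false, Real.one_rpow, one_mul,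
    ← Finset.mul_sum, ← Finset.sum_mul]
  ring

theorem sq_sum_div_card_le {m : ℕ} (a : Fin m → ℝ) :
    (∑ i, a i) ^ 2 * (1 / (m : ℝ)) ≤ ∑ i, a i ^ 2 := by
  rcases Nat.eq_zero_or_pos m with rfl | hm
  · simp
  · have h := sq_sum_le_card_mul_sum_sq (s := Finset.univ) (f := a)
    rw [Finset.card_univ, Fintype.card_fin] at h
    rw [mul_one_div, div_le_iff₀ (by exact_mod_cast hm)]
    linarith

/-- The space with parts of sizes `q, t ≥ 1`, distance `1` across and `c` within the parts has
`p`-negative type exactly when `c ^ p * (1 - (1 / q + 1 / t) / 2) ≤ 1`. -/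
theorem bipartiteDist_negativeType_iff {q t : ℕ} (hq : 1 ≤ q) (ht : 1 ≤ t) {c : ℝ}
    (hc : 0 ≤ c) (p : ℝ) :
    (∀ k : ℕ, 2 ≤ k → ∀ x : Fin k → Fin q ⊕ Fin t, Function.Injective x →
      ∀ η : Fin k → ℝ, (∑ l, η l = 0) →
        ∑ i, ∑ j, (if i = j then 0 else
          bipartiteDist q t c (x i) (x j) ^ p * (η i * η j)) ≤ 0) ↔
      c ^ p * (1 - 1 / 2 * (1 / (q : ℝ) + 1 / (t : ℝ))) ≤ 1 := by
  have hq' : (q : ℝ) ≠ 0 := by positivity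
  have ht' : (t : ℝ) ≠ 0 := by positivity
  constructor
  · intro h
    have hx : Function.Injective (finSumFinEquiv (m := q) (n := t)).symm := Equiv.injective _
    set f : Fin q ⊕ Fin t → ℝ := Sum.elim (fun _ => 1 / (q : ℝ)) (fun _ => -(1 / (t : ℝ)))
      with hf
    have hη : ∑ l, f (finSumFinEquiv.symm l) = 0 := by
      rw [Equiv.sum_comp finSumFinEquiv.symm f]
      simp [hf, hq', ht']
    have hform := h (q + t) (by omega) _ hx (fun l => f (finSumFinEquiv.symm l)) hη
    rw [offDiag_sum_eq_sum_extend hx (fun l => f (finSumFinEquiv.symm l))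
      (fun u v => bipartiteDist q t c u v ^ p)] at hform
    have hext : Function.extend (finSumFinEquiv (m := q) (n := t)).symm
        (fun l => f (finSumFinEquiv.symm l)) 0 = f := by
      ext y
      obtain ⟨l, rfl⟩ := (finSumFinEquiv (m := q) (n := t)).symm.surjective y
      rw [hx.extend_apply]
    rw [hext, bipartiteDist_form] at hform
    simp only [hf, Sum.elim_inl, Sum.elim_inr, Finset.sum_const, Finset.card_univ,
      Fintype.card_fin, nsmul_eq_mul] at hform
    field_simp at hform ⊢
    linarith
  · intro h k _ x hx η hη
    rw [offDiag_sum_eq_sum_extend hx η (fun u v => bipartiteDist q t c u v ^ p),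
      bipartiteDist_form]
    set f := Function.extend x η 0
    have hsum : ∑ y, f y = 0 := by
      rw [← hη]
      exact (sum_comp_injective_eq_sum_extend hx η (fun _ a => a) (by simp)).symm
    rw [Fintype.sum_sum_type] at hsum
    have ha := sq_sum_div_card_le (fun i => f (Sum.inl i))
    have hb := sq_sum_div_card_le (fun j => f (Sum.inr j))
    rw [eq_neg_of_add_eq_zero_right hsum] at hb ⊢
    set S := ∑ i, f (Sum.inl i)
    have hC : 0 ≤ c ^ p := Real.rpow_nonneg hc p
    have ha' := mul_le_mul_of_nonneg_left ha hC
    have hb' := mul_le_mul_of_nonneg_left hb hC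
    have hS := mul_le_mul_of_nonneg_left h (sq_nonneg S)
    linarith

/-- Remark 4.2: for `n ≥ 3`, `q = ⌊n/2⌋`, `t = ⌈n/2⌉`, the distance on the
`n`-point set `{a_1,…,a_q,b_1,…,b_t}` with `d(a_j,b_i) = 1` and all distances within each
part equal to `2` is a metric, and the resulting space has `p`-negative type if and only if
`0 ≤ p ≤ ζ(n,2) = ln(1/(1−Γ))/ln 2`, where `Γ = (1/2)(1/⌊n/2⌋ + 1/⌈n/2⌉)`.  In particular
its maximal `p`-negative type is exactly `ζ(n,2)`. -/
theorem bipartite_example_diameter_two (n : ℕ) (hn : 3 ≤ n)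
    (d : Fin (n / 2) ⊕ Fin ((n + 1) / 2) → Fin (n / 2) ⊕ Fin ((n + 1) / 2) → ℝ)
    (hd : d = bipartiteDist (n / 2) ((n + 1) / 2) 2)
    (Γ ζ : ℝ)
    (hΓ : Γ = 1 / 2 * (1 / ((n / 2 : ℕ) : ℝ) + 1 / (((n + 1) / 2 : ℕ) : ℝ)))
    (hζ : ζ = Real.log (1 / (1 - Γ)) / Real.log 2) :
    ((∀ x, d x x = 0) ∧ (∀ x y, d x y = d y x) ∧ (∀ x y, x ≠ y → 0 < d x y) ∧
      (∀ x y z, d x z ≤ d x y + d y z)) ∧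
    (∀ p : ℝ, 0 ≤ p →
      ((∀ (k : ℕ), 2 ≤ k →
          ∀ x : Fin k → Fin (n / 2) ⊕ Fin ((n + 1) / 2), Function.Injective x →
            ∀ η : Fin k → ℝ, (∑ l, η l = 0) →
              ∑ i, ∑ j, (if i = j then 0 else d (x i) (x j) ^ p * (η i * η j)) ≤ 0) ↔
        p ≤ ζ)) := by
  subst hd
  refine ⟨⟨bipartiteDist_self _ _ _, bipartiteDist_comm _ _ _,
    fun _ _ => bipartiteDist_pos _ _ two_pos,
    bipartiteDist_triangle _ _ one_le_two le_rfl⟩, fun p _ => ?_⟩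
  rw [bipartiteDist_negativeType_iff (by omega) (by omega) zero_le_two, ← hΓ, hζ]
  have hq : 1 / ((n / 2 : ℕ) : ℝ) ≤ 1 :=
    (div_le_one₀ (by exact_mod_cast (by omega : 0 < n / 2))).2
      (by exact_mod_cast (by omega : 1 ≤ n / 2))
  have ht : 1 / (((n + 1) / 2 : ℕ) : ℝ) ≤ 1 / 2 :=
    one_div_le_one_div_of_le two_pos (by exact_mod_cast (by omega : 2 ≤ (n + 1) / 2))
  have hpos : 0 < 1 - Γ := by linarith
  rw [le_div_iff₀ (Real.log_pos one_lt_two), ← Real.log_rpow two_pos,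
    Real.log_le_log_iff (by positivity) (by positivity), le_div_iff₀ hpos]
end

section
/- Let p ≥ 0 and let (X,d) be a metric space. Then (X,d) has p-negative type if and only if (X,d) has generalized roundness p; that is, the following are equivalent: (i) for every integer k ≥ 2, every choice of k distinct points x_1,…,x_k ∈ X, and all reals η_1,…,η_k with η_1+⋯+η_k = 0, one has Σ_{1≤i,j≤k} d(x_i,x_j)^p η_i η_j ≤ 0; (ii) for all positive integers q,t and every normalized (q,t)-simplex [a_j(m_j); b_i(n_i)]_{q,t} in X, one has Σ_{1≤j_1<j_2≤q} m_{j_1}m_{j_2} d(a_{j_1},a_{j_2})^p + Σ_{1≤i_1<i_2≤t} n_{i_1}n_{i_2} d(b_{i_1},b_{i_2})^p ≤ Σ_{j=1}^q Σ_{i=1}^t m_j n_i d(a_j,b_i)^p. -/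
open Finset

/-- The bilinear form `∑ K (x i) (y j) u i v j` attached to a kernel `K` on `X` and to two finite
weighted families of points. -/
noncomputable def kernelForm {X α β : Type*} [Fintype α] [Fintype β] (K : X → X → ℝ)
    (x : α → X) (y : β → X) (u : α → ℝ) (v : β → ℝ) : ℝ :=
  ∑ i, ∑ j, u i * v j * K (x i) (y j)

namespace kernelForm

variable {X α β γ δ : Type*} [Fintype α] [Fintype β] [Fintype γ] [Fintype δ] (K : X → X → ℝ)

theorem comp_equiv (e : γ ≃ α) (f : δ ≃ β) (x : α → X) (y : β → X) (u : α → ℝ) (v : β → ℝ) :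
    kernelForm K (x ∘ e) (y ∘ f) (u ∘ e) (v ∘ f) = kernelForm K x y u v := by
  unfold kernelForm
  rw [← e.sum_comp]
  refine sum_congr rfl fun i _ => ?_
  rw [← f.sum_comp]
  rfl

theorem symm (hK : ∀ x y, K x y = K y x) (x : α → X) (y : β → X) (u : α → ℝ) (v : β → ℝ) :
    kernelForm K x y u v = kernelForm K y x v u := by
  unfold kernelForm
  rw [sum_comm]
  refine sum_congr rfl fun i _ => sum_congr rfl fun j _ => ?_
  rw [hK, mul_comm (u j)]

theorem smul_smul (c d : ℝ) (x : α → X) (y : β → X) (u : α → ℝ) (v : β → ℝ) :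
    kernelForm K x y (c • u) (d • v) = c * d * kernelForm K x y u v := by
  unfold kernelForm
  simp only [mul_sum, Pi.smul_apply, smul_eq_mul]
  refine sum_congr rfl fun i _ => sum_congr rfl fun j _ => ?_
  ring

/-- Expansion of the quadratic form of a signed family split into its two halves. -/
theorem sum_elim (hK : ∀ x y, K x y = K y x) (a : α → X) (b : β → X) (m : α → ℝ) (n : β → ℝ) :
    kernelForm K (Sum.elim a b) (Sum.elim a b) (Sum.elim m (-n)) (Sum.elim m (-n)) =
      kernelForm K a a m m + kernelForm K b b n n - 2 * kernelForm K a b m n := by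
  have h := symm K hK b a n m
  unfold kernelForm at h ⊢
  simp only [Fintype.sum_sum_type, Sum.elim_inl, Sum.elim_inr, Pi.neg_apply, sum_add_distrib,
    neg_mul, mul_neg, sum_neg_distrib, h]
  ring

/-- For a symmetric kernel vanishing on the diagonal, the quadratic form is twice its strictly
upper triangular part. -/
theorem eq_two_mul_sum_lt [LinearOrder α] (hK : ∀ x y, K x y = K y x) (h0 : ∀ x, K x x = 0)
    (x : α → X) (u : α → ℝ) :
    kernelForm K x x u u =
      2 * ∑ i, ∑ j, if i < j then u i * u j * K (x i) (x j) else 0 := by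
  have h : ∑ i, ∑ j, (if i < j then u i * u j * K (x i) (x j) else 0) =
      ∑ i, ∑ j, (if j < i then u i * u j * K (x i) (x j) else 0) := by
    rw [sum_comm]
    refine sum_congr rfl fun i _ => sum_congr rfl fun j _ => ?_
    rw [hK, mul_comm (u j)]
  rw [two_mul]
  nth_rw 2 [h]
  simp only [kernelForm, ← sum_add_distrib]
  refine sum_congr rfl fun i _ => sum_congr rfl fun j _ => ?_
  rcases lt_trichotomy i j with hij | rfl | hij
  · simp [hij, hij.not_gt]
  · simp [h0]
  · simp [hij, hij.not_gt]

end kernelForm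

/-- A sum of terms vanishing with `η` splits over the positive and the negative part of `η`. -/
theorem sum_eq_sum_pos_add_sum_neg {ι : Type*} [Fintype ι] (η f : ι → ℝ)
    (hf : ∀ i, η i = 0 → f i = 0) :
    ∑ i, f i = ∑ i : {i // 0 < η i}, f i + ∑ i : {i // η i < 0}, f i := by
  rw [← sum_subtype (univ.filter fun i => 0 < η i) (by simp) f,
    ← sum_subtype (univ.filter fun i => η i < 0) (by simp) f, sum_filter, sum_filter,
    ← sum_add_distrib]
  refine sum_congr rfl fun i _ => ?_
  rcases lt_trichotomy (η i) 0 with h | h | h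
  · simp [h, h.not_gt]
  · simp [h, hf i h]
  · simp [h, h.not_gt]

/-- The `p`-th power of the distance, with the value `0` on the diagonal also for `p = 0`. -/
noncomputable def distPow {X : Type*} [MetricSpace X] (p : ℝ) (x y : X) : ℝ :=
  open Classical in if x = y then 0 else dist x y ^ p

namespace distPow

variable {X : Type*} [MetricSpace X] (p : ℝ)

theorem self (x : X) : distPow p x x = 0 := by simp [distPow]

theorem of_ne {x y : X} (h : x ≠ y) : distPow p x y = dist x y ^ p := by simp [distPow, h]

theorem comm (x y : X) : distPow p x y = distPow p y x := by
  obtain rfl | h := eq_or_ne x y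
  · rfl
  · rw [of_ne p h, of_ne p h.symm, dist_comm]

theorem sum_offDiag_eq {α : Type*} [Fintype α] [DecidableEq α] {x : α → X}
    (hx : Function.Injective x) (η : α → ℝ) :
    ∑ i, ∑ j, (if i = j then 0 else dist (x i) (x j) ^ p * (η i * η j)) =
      kernelForm (distPow p) x x η η := by
  refine sum_congr rfl fun i _ => sum_congr rfl fun j _ => ?_
  split_ifs with h
  · simp [h, self]
  · rw [of_ne p (hx.ne h), mul_comm]

theorem two_mul_sum_lt_eq {α : Type*} [Fintype α] [LinearOrder α] {x : α → X}
    (hx : Function.Injective x) (u : α → ℝ) :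
    2 * ∑ i, ∑ j, (if i < j then u i * u j * dist (x i) (x j) ^ p else 0) =
      kernelForm (distPow p) x x u u := by
  rw [kernelForm.eq_two_mul_sum_lt _ (comm p) (self p)]
  congr 1
  refine sum_congr rfl fun i _ => sum_congr rfl fun j _ => ?_
  split_ifs with h
  · rw [of_ne p (hx.ne h.ne)]
  · rfl

theorem sum_cross_eq {α β : Type*} [Fintype α] [Fintype β] {a : α → X} {b : β → X}
    (hab : Function.Injective (Sum.elim a b)) (m : α → ℝ) (n : β → ℝ) :
    ∑ j, ∑ i, m j * n i * dist (a j) (b i) ^ p = kernelForm (distPow p) a b m n := by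
  refine sum_congr rfl fun j _ => sum_congr rfl fun i _ => ?_
  have h : a j ≠ b i := hab.ne Sum.inl_ne_inr
  rw [of_ne p h]

end distPow

/-- Theorem 2.4(a), Lennard–Tonge–Weston: a metric space has `p`-negative
type if and only if it has generalized roundness `p`. -/
theorem negative_type_iff_generalized_roundness {X : Type*} [MetricSpace X]
    (p : ℝ) (hp : 0 ≤ p) :
    (∀ (k : ℕ), 2 ≤ k → ∀ x : Fin k → X, Function.Injective x →
        ∀ η : Fin k → ℝ, (∑ l, η l = 0) →
          ∑ i, ∑ j, (if i = j then 0 else dist (x i) (x j) ^ p * (η i * η j)) ≤ 0) ↔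
    (∀ (q t : ℕ), 0 < q → 0 < t →
        ∀ (a : Fin q → X) (b : Fin t → X), Function.Injective (Sum.elim a b) →
          ∀ (m : Fin q → ℝ) (n : Fin t → ℝ),
            (∀ j, 0 < m j) → (∀ i, 0 < n i) → (∑ j, m j = 1) → (∑ i, n i = 1) →
            (∑ j₁ : Fin q, ∑ j₂ : Fin q,
                if j₁ < j₂ then m j₁ * m j₂ * dist (a j₁) (a j₂) ^ p else 0)
              + (∑ i₁ : Fin t, ∑ i₂ : Fin t,
                  if i₁ < i₂ then n i₁ * n i₂ * dist (b i₁) (b i₂) ^ p else 0)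
            ≤ ∑ j : Fin q, ∑ i : Fin t, m j * n i * dist (a j) (b i) ^ p) := by
  constructor
  · intro H q t hq ht a b hab m n _ _ hm1 hn1
    have h := H (q + t) (by omega) (Sum.elim a b ∘ finSumFinEquiv.symm)
      (hab.comp finSumFinEquiv.symm.injective) (Sum.elim m (-n) ∘ finSumFinEquiv.symm) (by
        simp only [Function.comp_apply]
        rw [finSumFinEquiv.symm.sum_comp (Sum.elim m (-n))]
        simp [hm1, hn1])
    rw [distPow.sum_offDiag_eq p (hab.comp finSumFinEquiv.symm.injective),
      kernelForm.comp_equiv, kernelForm.sum_elim _ (distPow.comm p)] at h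
    have ha := distPow.two_mul_sum_lt_eq p (x := a) (hab.comp Sum.inl_injective) m
    have hb := distPow.two_mul_sum_lt_eq p (x := b) (hab.comp Sum.inr_injective) n
    rw [distPow.sum_cross_eq p hab]
    linarith
  · intro H k _ x hx η hη
    rw [distPow.sum_offDiag_eq p hx]
    let P := {i // 0 < η i}
    let N := {i // η i < 0}
    let a : P → X := fun i => x i
    let b : N → X := fun i => x i
    let m : P → ℝ := fun i => η i
    let n : N → ℝ := fun i => -η i
    have hab : Function.Injective (Sum.elim a b) :=
      (hx.comp Subtype.val_injective).sumElim (hx.comp Subtype.val_injective)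
        fun i j hij => (i.2.trans_eq (congrArg η (hx hij))).not_gt j.2
    have hsplit : kernelForm (distPow p) x x η η =
        kernelForm (distPow p) (Sum.elim a b) (Sum.elim a b) (Sum.elim m (-n))
          (Sum.elim m (-n)) := by
      unfold kernelForm
      rw [sum_eq_sum_pos_add_sum_neg η _ fun i hi => by simp [hi], Fintype.sum_sum_type]
      congr 1 <;> refine sum_congr rfl fun i _ => ?_ <;>
        rw [sum_eq_sum_pos_add_sum_neg η _ fun j hj => by simp [hj], Fintype.sum_sum_type] <;>
        simp [a, b, m, n] <;> rfl
    have hmn : ∑ i, m i = ∑ i, n i := by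
      rw [sum_eq_sum_pos_add_sum_neg η η fun _ h => h] at hη
      simp only [m, n, sum_neg_distrib]
      linarith
    rw [hsplit]
    rcases isEmpty_or_nonempty P with hP | hP
    · have hN : IsEmpty N := by
        by_contra hN
        rw [not_isEmpty_iff] at hN
        have : 0 < ∑ i, n i := sum_pos (fun i _ => neg_pos.2 i.2) univ_nonempty
        rw [← hmn, univ_eq_empty, sum_empty] at this
        exact this.false
      simp [kernelForm]
    have hs : 0 < ∑ i, m i := sum_pos (fun i _ => i.2) univ_nonempty
    have hN : Nonempty N := by
      by_contra hN
      rw [not_nonempty_iff] at hN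
      rw [hmn, univ_eq_empty, sum_empty] at hs
      exact hs.false
    set s := ∑ i, m i with hsdef
    have hs' : 0 < s⁻¹ := inv_pos.2 hs
    let e := (Fintype.equivFin P).symm
    let f := (Fintype.equivFin N).symm
    have hab' : Function.Injective (Sum.elim (a ∘ e) (b ∘ f)) := by
      rw [← Sum.elim_comp_map]
      exact hab.comp (Sum.map_injective.2 ⟨e.injective, f.injective⟩)
    have h := H (Fintype.card P) (Fintype.card N) Fintype.card_pos Fintype.card_pos
      (a ∘ e) (b ∘ f) hab' ((s⁻¹ • m) ∘ e) ((s⁻¹ • n) ∘ f)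
      (fun j => mul_pos hs' (e j).2) (fun i => mul_pos hs' (neg_pos.2 (f i).2))
      (by
        simp only [Function.comp_apply]
        rw [e.sum_comp (s⁻¹ • m)]
        simp only [Pi.smul_apply, smul_eq_mul, ← mul_sum, ← hsdef]
        exact inv_mul_cancel₀ hs.ne')
      (by
        simp only [Function.comp_apply]
        rw [f.sum_comp (s⁻¹ • n)]
        simp only [Pi.smul_apply, smul_eq_mul, ← mul_sum, ← hmn]
        exact inv_mul_cancel₀ hs.ne')
    have ha := distPow.two_mul_sum_lt_eq p (x := a ∘ e) (hab'.comp Sum.inl_injective)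
      ((s⁻¹ • m) ∘ e)
    have hb := distPow.two_mul_sum_lt_eq p (x := b ∘ f) (hab'.comp Sum.inr_injective)
      ((s⁻¹ • n) ∘ f)
    rw [distPow.sum_cross_eq p hab'] at h
    rw [kernelForm.comp_equiv, kernelForm.smul_smul] at ha hb h
    rw [kernelForm.sum_elim _ (distPow.comm p)]
    refine nonpos_of_mul_nonpos_right ?_ (mul_pos hs' hs')
    linarith
end

section
/- Let p ≥ 0 and let (X,d) be a metric space. Then (X,d) has strict p-negative type if and only if it has strict generalized roundness p; that is, the following are equivalent: (i) for every integer k ≥ 2, every choice of k distinct points x_1,…,x_k ∈ X, and all reals η_1,…,η_k with η_1+⋯+η_k = 0 and (η_1,…,η_k) ≠ (0,…,0), one has Σ_{1≤i,j≤k} d(x_i,x_j)^p η_i η_j < 0; (ii) for all positive integers q,t and every normalized (q,t)-simplex [a_j(m_j); b_i(n_i)]_{q,t} in X, one has Σ_{1≤j_1<j_2≤q} m_{j_1}m_{j_2} d(a_{j_1},a_{j_2})^p + Σ_{1≤i_1<i_2≤t} n_{i_1}n_{i_2} d(b_{i_1},b_{i_2})^p < Σ_{j=1}^q Σ_{i=1}^t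 m_j n_i d(a_j,b_i)^p. -/
/-- The quadratic form `∑ d(x i, x j) ^ p * η i * η j` over pairs of distinct indices. -/
noncomputable def distEnergy {X ι : Type*} [MetricSpace X] [Fintype ι] [DecidableEq ι]
    (p : ℝ) (x : ι → X) (η : ι → ℝ) : ℝ :=
  ∑ i, ∑ j, if i = j then 0 else dist (x i) (x j) ^ p * (η i * η j)

section distEnergy

variable {X ι κ : Type*} [MetricSpace X] [Fintype ι] [DecidableEq ι] [Fintype κ] [DecidableEq κ]

/-- Points of weight zero do not contribute to the energy. -/
theorem distEnergy_comp_of_injective (p : ℝ) (x : ι → X) (η : ι → ℝ) {φ : κ → ι}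
    (hφ : Function.Injective φ) (h : ∀ i ∉ Set.range φ, η i = 0) :
    distEnergy p (x ∘ φ) (η ∘ φ) = distEnergy p x η := by
  refine Fintype.sum_of_injective φ hφ _ _ (fun i hi => ?_) fun i => ?_
  · simp [h i hi]
  · refine Fintype.sum_of_injective φ hφ _ _ (fun j hj => ?_) fun j => ?_
    · simp [h j hj]
    · simp [hφ.eq_iff]

theorem distEnergy_smul (p c : ℝ) (x : ι → X) (η : ι → ℝ) :
    distEnergy p x (c • η) = c ^ 2 * distEnergy p x η := by
  simp only [distEnergy, Finset.mul_sum, mul_ite, mul_zero, Pi.smul_apply, smul_eq_mul]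
  refine Finset.sum_congr rfl fun i _ => Finset.sum_congr rfl fun j _ => ?_
  split_ifs
  · rfl
  · ring

theorem distEnergy_sumElim (p : ℝ) (a : ι → X) (b : κ → X)
    (m : ι → ℝ) (n : κ → ℝ) :
    distEnergy p (Sum.elim a b) (Sum.elim m (-n)) =
      distEnergy p a m + distEnergy p b n
        - 2 * ∑ j, ∑ i, m j * n i * dist (a j) (b i) ^ p := by
  have hcomm : ∑ i, ∑ j, dist (b i) (a j) ^ p * (n i * m j) =
      ∑ j, ∑ i, m j * n i * dist (a j) (b i) ^ p := by
    rw [Finset.sum_comm]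
    refine Finset.sum_congr rfl fun j _ => Finset.sum_congr rfl fun i _ => ?_
    rw [dist_comm]
    ring
  have hcomm' : ∑ j, ∑ i, dist (a j) (b i) ^ p * (m j * n i) =
      ∑ j, ∑ i, m j * n i * dist (a j) (b i) ^ p :=
    Finset.sum_congr rfl fun j _ => Finset.sum_congr rfl fun i _ => mul_comm _ _
  simp only [distEnergy, Fintype.sum_sum_type, Sum.elim_inl, Sum.elim_inr, Sum.inl.injEq,
    Sum.inr.injEq, reduceCtorEq, if_false, Finset.sum_add_distrib, Pi.neg_apply, mul_neg,
    neg_mul, neg_neg, Finset.sum_neg_distrib, hcomm, hcomm']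
  ring

theorem distEnergy_eq_two_mul_sum_lt [LinearOrder κ] (p : ℝ) (x : κ → X) (η : κ → ℝ) :
    distEnergy p x η =
      2 * ∑ i, ∑ j, if i < j then η i * η j * dist (x i) (x j) ^ p else 0 := by
  have hswap : ∑ i, ∑ j, (if i < j then η i * η j * dist (x i) (x j) ^ p else 0) =
      ∑ i, ∑ j, if j < i then η i * η j * dist (x i) (x j) ^ p else 0 := by
    rw [Finset.sum_comm]
    refine Finset.sum_congr rfl fun i _ => Finset.sum_congr rfl fun j _ => ?_
    rw [dist_comm, mul_comm (η j)]
  rw [two_mul]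
  nth_rewrite 2 [hswap]
  simp only [distEnergy, ← Finset.sum_add_distrib]
  refine Finset.sum_congr rfl fun i _ => Finset.sum_congr rfl fun j _ => ?_
  rcases lt_trichotomy i j with h | rfl | h
  · simp [h, h.ne, h.not_gt, mul_comm]
  · simp
  · simp [h, h.ne', h.not_gt, mul_comm]

end distEnergy

/-- The simplex inequality says that the energy of the associated signed weights is negative. -/
theorem distEnergy_simplex_neg_iff {X : Type*} [MetricSpace X] (p : ℝ) {q t : ℕ}
    (a : Fin q → X) (b : Fin t → X) (m : Fin q → ℝ) (n : Fin t → ℝ) :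
    distEnergy p (Sum.elim a b) (Sum.elim m (-n)) < 0 ↔
      (∑ j₁ : Fin q, ∑ j₂ : Fin q,
          if j₁ < j₂ then m j₁ * m j₂ * dist (a j₁) (a j₂) ^ p else 0)
        + (∑ i₁ : Fin t, ∑ i₂ : Fin t,
            if i₁ < i₂ then n i₁ * n i₂ * dist (b i₁) (b i₂) ^ p else 0)
      < ∑ j : Fin q, ∑ i : Fin t, m j * n i * dist (a j) (b i) ^ p := by
  rw [distEnergy_sumElim p a b, distEnergy_eq_two_mul_sum_lt p a,
    distEnergy_eq_two_mul_sum_lt p b]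
  constructor <;> intro h <;> linarith

/-- A finite family of reals is carried by enumerations of its positive and negative parts. -/
theorem exists_enumeration_pos_neg {ι : Type*} [Fintype ι] (η : ι → ℝ) :
    ∃ (q t : ℕ) (e : Fin q → ι) (f : Fin t → ι), Function.Injective (Sum.elim e f) ∧
      (∀ j, 0 < η (e j)) ∧ (∀ i, η (f i) < 0) ∧
      ∀ l ∉ Set.range (Sum.elim e f), η l = 0 := by
  classical
  let E := Fintype.equivFin {l // 0 < η l}
  let F := Fintype.equivFin {l // η l < 0}
  have he (j) : 0 < η (E.symm j) := (E.symm j).2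
  have hf (i) : η (F.symm i) < 0 := (F.symm i).2
  refine ⟨_, _, fun j => E.symm j, fun i => F.symm i, ?_, he, hf, fun l hl => ?_⟩
  · refine (Subtype.val_injective.comp E.symm.injective).sumElim
      (Subtype.val_injective.comp F.symm.injective) fun j i h => ?_
    have h' : ((E.symm j : {l // 0 < η l}) : ι) = F.symm i := h
    exact lt_asymm (he j) (h' ▸ hf i)
  · by_contra hne
    rcases lt_or_gt_of_ne hne with h | h
    · exact hl ⟨Sum.inr (F ⟨l, h⟩), by simp⟩
    · exact hl ⟨Sum.inl (E ⟨l, h⟩), by simp⟩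

/-- Theorem 2.4(b), Doust–Weston: a metric space has strict `p`-negative
type if and only if it has strict generalized roundness `p`. -/
theorem strict_negative_type_iff_strict_generalized_roundness {X : Type*} [MetricSpace X]
    (p : ℝ) (hp : 0 ≤ p) :
    (∀ (k : ℕ), 2 ≤ k → ∀ x : Fin k → X, Function.Injective x →
        ∀ η : Fin k → ℝ, (∑ l, η l = 0) → η ≠ 0 →
          ∑ i, ∑ j, (if i = j then 0 else dist (x i) (x j) ^ p * (η i * η j)) < 0) ↔
    (∀ (q t : ℕ), 0 < q → 0 < t →
        ∀ (a : Fin q → X) (b : Fin t → X), Function.Injective (Sum.elim a b) →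
          ∀ (m : Fin q → ℝ) (n : Fin t → ℝ),
            (∀ j, 0 < m j) → (∀ i, 0 < n i) → (∑ j, m j = 1) → (∑ i, n i = 1) →
            (∑ j₁ : Fin q, ∑ j₂ : Fin q,
                if j₁ < j₂ then m j₁ * m j₂ * dist (a j₁) (a j₂) ^ p else 0)
              + (∑ i₁ : Fin t, ∑ i₂ : Fin t,
                  if i₁ < i₂ then n i₁ * n i₂ * dist (b i₁) (b i₂) ^ p else 0)
            < ∑ j : Fin q, ∑ i : Fin t, m j * n i * dist (a j) (b i) ^ p) := by
  constructor
  · intro H q t hq ht a b hab m n hm hn hms hns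
    rw [← distEnergy_simplex_neg_iff p a b]
    let φ : Fin (q + t) ≃ Fin q ⊕ Fin t := finSumFinEquiv.symm
    rw [← distEnergy_comp_of_injective p _ _ φ.injective fun i hi => (hi (φ.surjective i)).elim]
    refine H (q + t) (by omega) _ (hab.comp φ.injective) _ ?_ fun h => ?_
    · calc ∑ l, (Sum.elim m (-n) ∘ φ) l = ∑ l, Sum.elim m (-n) l :=
            Equiv.sum_comp φ (Sum.elim m (-n))
        _ = 0 := by simp [Fintype.sum_sum_type, hms, hns]
    · have h0 := congrFun h (φ.symm (Sum.inl ⟨0, hq⟩))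
      simp only [Function.comp_apply, Equiv.apply_symm_apply, Sum.elim_inl, Pi.zero_apply] at h0
      exact (hm _).ne' h0
  · intro H k _ x hx η hη hne
    change distEnergy p x η < 0
    obtain ⟨q, t, e, f, hinj, he, hf, hzero⟩ := exists_enumeration_pos_neg η
    have hsum : ∑ j, η (e j) + ∑ i, η (f i) = 0 := by
      rw [← hη, ← Fintype.sum_of_injective _ hinj (η ∘ Sum.elim e f) η hzero fun _ => rfl]
      simp [Fintype.sum_sum_type]
    have hqt : 0 < q ∨ 0 < t := by
      obtain ⟨l, hl⟩ := Function.ne_iff.mp hne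
      obtain ⟨r, -⟩ := not_imp_comm.mp (hzero l) hl
      rcases r with j | i
      · exact Or.inl j.pos
      · exact Or.inr i.pos
    have hepos (h : 0 < q) : 0 < ∑ j, η (e j) :=
      Finset.sum_pos (fun j _ => he j) ⟨⟨0, h⟩, Finset.mem_univ _⟩
    have hfneg (h : 0 < t) : ∑ i, η (f i) < 0 :=
      Finset.sum_neg (fun i _ => hf i) ⟨⟨0, h⟩, Finset.mem_univ _⟩
    have hs : 0 < ∑ j, η (e j) := by
      rcases hqt with h | h
      · exact hepos h
      · linarith [hfneg h]
    have hq : 0 < q := Nat.pos_of_ne_zero fun h => by subst h; simp at hs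
    have ht : 0 < t := Nat.pos_of_ne_zero fun h => by
      subst h
      simp only [Finset.univ_eq_empty, Finset.sum_empty, add_zero] at hsum
      exact hs.ne' hsum
    set s := ∑ j, η (e j) with hs_def
    have hcomp : x ∘ Sum.elim e f = Sum.elim (x ∘ e) (x ∘ f) := Sum.comp_elim x e f
    have hab : Function.Injective (Sum.elim (x ∘ e) (x ∘ f)) := hcomp ▸ hx.comp hinj
    have hlt := (distEnergy_simplex_neg_iff p _ _ _ _).mpr <|
      H q t hq ht (x ∘ e) (x ∘ f) hab (fun j => η (e j) / s) (fun i => -η (f i) / s)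
        (fun j => div_pos (he j) hs) (fun i => div_pos (neg_pos.mpr (hf i)) hs)
        (by rw [← Finset.sum_div, ← hs_def, div_self hs.ne'])
        (by rw [← Finset.sum_div, Finset.sum_neg_distrib, neg_eq_of_add_eq_zero_left hsum,
          div_self hs.ne'])
    have hweights : η ∘ Sum.elim e f =
        s • Sum.elim (fun j => η (e j) / s) (-fun i => -η (f i) / s) := by
      ext (j | i) <;> simp <;> field_simp
    rw [← distEnergy_comp_of_injective p x η hinj hzero, hcomp, hweights, distEnergy_smul]
    exact mul_neg_of_pos_of_neg (by positivity) hlt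
end

section
/- Let p ≥ 0, let (X,d) be a metric space with p-negative type, and let Γ ≥ 0. Then the following are equivalent: (i) for all positive integers q,t and every normalized (q,t)-simplex [a_j(m_j); b_i(n_i)]_{q,t} in X, one has Γ + Σ_{1≤j_1<j_2≤q} m_{j_1}m_{j_2} d(a_{j_1},a_{j_2})^p + Σ_{1≤i_1<i_2≤t} n_{i_1}n_{i_2} d(b_{i_1},b_{i_2})^p ≤ Σ_{j=1}^q Σ_{i=1}^t m_j n_i d(a_j,b_i)^p; (ii) for every integer k ≥ 2, every choice of k distinct points x_1,…,x_k ∈ X, and all reals η_1,…,η_k with η_1+⋯+η_k = 0, one has (Γ/2)(Σ_{ℓ=1}^k |η_ℓ|)^2 + Σ_{1≤i,j≤k} d(x_i,x_j)^p η_i η_j ≤ 0. -/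
open Finset in
/-- For a symmetric kernel, the off-diagonal double sum is twice the strictly upper triangular one. -/
lemma sum_offDiag_eq_two_mul_sum_lt {ι : Type*} [Fintype ι] [LinearOrder ι] (f : ι → ι → ℝ)
    (hf : ∀ i j, f i j = f j i) :
    ∑ i, ∑ j, (if i = j then 0 else f i j) = 2 * ∑ i, ∑ j, (if i < j then f i j else 0) := by
  have hswap : ∑ i, ∑ j, (if j < i then f i j else 0) = ∑ i, ∑ j, (if i < j then f i j else 0) := by
    rw [sum_comm]
    simp only [hf]
  rw [two_mul]
  nth_rewrite 2 [← hswap]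
  simp only [← sum_add_distrib]
  refine sum_congr rfl fun i _ => sum_congr rfl fun j _ => ?_
  rcases lt_trichotomy i j with h | h | h
  · simp [h, h.ne, h.not_gt]
  · simp [h]
  · simp [h, h.ne', h.not_gt]

/-- The `p`-negative type form of a family of points with real weights. -/
noncomputable def negTypeForm {X ι : Type*} [MetricSpace X] [Fintype ι] [DecidableEq ι] (p : ℝ)
    (x : ι → X) (η : ι → ℝ) : ℝ :=
  ∑ i, ∑ j, (if i = j then 0 else dist (x i) (x j) ^ p * (η i * η j))

section negTypeForm

variable {X ι κ : Type*} [MetricSpace X] [Fintype ι] [DecidableEq ι] [Fintype κ] [DecidableEq κ]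

/-- The form is unchanged by restricting to an index set that covers the support of the weights. -/
lemma negTypeForm_comp (p : ℝ) (x : ι → X) (η : ι → ℝ) (w : κ → ι) (hw : Function.Injective w)
    (hη : ∀ i ∉ Set.range w, η i = 0) :
    negTypeForm p (x ∘ w) (η ∘ w) = negTypeForm p x η := by
  unfold negTypeForm
  refine Fintype.sum_of_injective w hw _ _ (fun i hi => by simp [hη i hi]) fun i => ?_
  refine Fintype.sum_of_injective w hw _ _ (fun j hj => by simp [hη j hj]) fun j => ?_
  simp [hw.eq_iff]

lemma negTypeForm_const_mul (p c : ℝ) (x : ι → X) (η : ι → ℝ) :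
    negTypeForm p x (fun i => c * η i) = c ^ 2 * negTypeForm p x η := by
  simp only [negTypeForm, Finset.mul_sum]
  refine Finset.sum_congr rfl fun i _ => Finset.sum_congr rfl fun j _ => ?_
  split_ifs <;> ring

/-- The form of a simplex, with positive weights on one side and negative weights on the other. -/
lemma negTypeForm_sumElim {q t : ℕ} (p : ℝ) (a : Fin q → X) (b : Fin t → X)
    (m : Fin q → ℝ) (n : Fin t → ℝ) :
    negTypeForm p (Sum.elim a b) (Sum.elim m (-n)) =
      2 * ((∑ j₁ : Fin q, ∑ j₂ : Fin q,
                if j₁ < j₂ then m j₁ * m j₂ * dist (a j₁) (a j₂) ^ p else 0)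
              + (∑ i₁ : Fin t, ∑ i₂ : Fin t,
                  if i₁ < i₂ then n i₁ * n i₂ * dist (b i₁) (b i₂) ^ p else 0)
            - ∑ j : Fin q, ∑ i : Fin t, m j * n i * dist (a j) (b i) ^ p) := by
  have ha := sum_offDiag_eq_two_mul_sum_lt (fun j₁ j₂ => m j₁ * m j₂ * dist (a j₁) (a j₂) ^ p)
    fun i j => by rw [dist_comm, mul_comm (m i)]
  have hb := sum_offDiag_eq_two_mul_sum_lt (fun i₁ i₂ => n i₁ * n i₂ * dist (b i₁) (b i₂) ^ p)
    fun i j => by rw [dist_comm, mul_comm (n i)]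
  have hab : ∑ i : Fin t, ∑ j : Fin q, m j * n i * dist (b i) (a j) ^ p =
      ∑ j : Fin q, ∑ i : Fin t, m j * n i * dist (a j) (b i) ^ p := by
    rw [Finset.sum_comm]
    simp only [dist_comm]
  rw [mul_sub, mul_add, ← ha, ← hb, two_mul]
  nth_rewrite 1 [← hab]
  simp only [negTypeForm, Fintype.sum_sum_type, Sum.elim_inl, Sum.elim_inr, Sum.inl.injEq,
    Sum.inr.injEq, reduceCtorEq, if_false, Finset.sum_add_distrib, Pi.neg_apply, neg_mul, mul_neg,
    neg_neg, Finset.sum_neg_distrib, mul_comm]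
  ring

end negTypeForm

/-- Remark 2.7: for a metric space `X` of `p`-negative type and a constant
`Γ ≥ 0`, the normalized generalized-roundness form of the gap inequalities holds for `Γ`
if and only if the scaled classical `p`-negative type form
`(Γ/2)(Σ|η_ℓ|)² + Σ d(x_i,x_j)^p η_i η_j ≤ 0` holds for `Γ`. -/
theorem gap_descriptions_equivalent {X : Type*} [MetricSpace X]
    (p : ℝ) (hp : 0 ≤ p) (Γ : ℝ) (hΓ : 0 ≤ Γ)
    (hneg : ∀ (k : ℕ), 2 ≤ k → ∀ x : Fin k → X, Function.Injective x →
        ∀ η : Fin k → ℝ, (∑ l, η l = 0) →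
          ∑ i, ∑ j, (if i = j then 0 else dist (x i) (x j) ^ p * (η i * η j)) ≤ 0) :
    (∀ (q t : ℕ), 0 < q → 0 < t →
        ∀ (a : Fin q → X) (b : Fin t → X), Function.Injective (Sum.elim a b) →
          ∀ (m : Fin q → ℝ) (n : Fin t → ℝ),
            (∀ j, 0 < m j) → (∀ i, 0 < n i) → (∑ j, m j = 1) → (∑ i, n i = 1) →
            Γ + (∑ j₁ : Fin q, ∑ j₂ : Fin q,
                if j₁ < j₂ then m j₁ * m j₂ * dist (a j₁) (a j₂) ^ p else 0)
              + (∑ i₁ : Fin t, ∑ i₂ : Fin t,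
                  if i₁ < i₂ then n i₁ * n i₂ * dist (b i₁) (b i₂) ^ p else 0)
            ≤ ∑ j : Fin q, ∑ i : Fin t, m j * n i * dist (a j) (b i) ^ p) ↔
    (∀ (k : ℕ), 2 ≤ k → ∀ x : Fin k → X, Function.Injective x →
        ∀ η : Fin k → ℝ, (∑ l, η l = 0) →
          Γ / 2 * (∑ l, |η l|) ^ 2
            + ∑ i, ∑ j, (if i = j then 0 else dist (x i) (x j) ^ p * (η i * η j)) ≤ 0) := by
  constructor
  · intro h k hk x hx η hη
    change Γ / 2 * (∑ l, |η l|) ^ 2 + negTypeForm p x η ≤ 0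
    rcases (Finset.sum_nonneg fun l _ => abs_nonneg (η l)).eq_or_lt with h0 | hpos
    · rw [← h0]
      simpa [negTypeForm] using hneg k hk x hx η hη
    set T := ∑ l, |η l| with hT
    let u := (Fintype.equivFin {i // 0 < η i}).symm
    let v := (Fintype.equivFin {i // η i < 0}).symm
    let w : Fin (Fintype.card {i // 0 < η i}) ⊕ Fin (Fintype.card {i // η i < 0}) → Fin k :=
      Sum.elim (fun j => (u j : Fin k)) fun j => (v j : Fin k)
    have hw : Function.Injective w :=
      (Subtype.val_injective.comp u.injective).sumElim (Subtype.val_injective.comp v.injective)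
        fun i j hij => by
          have hi := (u i).2
          have hj := (v j).2
          have hij' : (u i : Fin k) = v j := hij
          rw [hij'] at hi
          exact lt_asymm hi hj
    have hsupp : ∀ i ∉ Set.range w, η i = 0 := by
      intro i hi
      by_contra hne
      rcases lt_or_gt_of_ne hne with hlt | hgt
      · exact hi ⟨Sum.inr (v.symm ⟨i, hlt⟩), by simp [w]⟩
      · exact hi ⟨Sum.inl (u.symm ⟨i, hgt⟩), by simp [w]⟩
    have hsum : ∑ j, η (u j) + ∑ j, η (v j) = 0 := by
      refine Eq.trans ?_ ((Fintype.sum_of_injective w hw (η ∘ w) η hsupp fun _ => rfl).trans hη)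
      simp [w]
    have habs : ∑ j, η (u j) - ∑ j, η (v j) = T := by
      rw [hT, ← Fintype.sum_of_injective w hw (fun i => |η (w i)|) (fun i => |η i|)
        (fun i hi => by simp [hsupp i hi]) fun _ => rfl]
      simp [w, abs_of_pos (u _).2, abs_of_neg (v _).2, sub_eq_add_neg]
    have hm : ∑ j, 2 / T * η (u j) = 1 := by
      rw [← Finset.mul_sum]
      field_simp
      linarith
    have hn : ∑ j, 2 / T * -η (v j) = 1 := by
      rw [← Finset.mul_sum, Finset.sum_neg_distrib]
      field_simp
      linarith
    have hq : 0 < Fintype.card {i // 0 < η i} := by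
      by_contra! hc
      have : IsEmpty (Fin (Fintype.card {i // 0 < η i})) := by
        rw [Nat.le_zero.mp hc]
        infer_instance
      simp at hm
    have ht : 0 < Fintype.card {i // η i < 0} := by
      by_contra! hc
      have : IsEmpty (Fin (Fintype.card {i // η i < 0})) := by
        rw [Nat.le_zero.mp hc]
        infer_instance
      simp at hn
    have hxw : Sum.elim (fun j => x (u j)) (fun j => x (v j)) = x ∘ w :=
      (Sum.comp_elim x _ _).symm
    have key := h _ _ hq ht (fun j => x (u j)) (fun j => x (v j)) (hxw ▸ hx.comp hw)
      (fun j => 2 / T * η (u j)) (fun j => 2 / T * -η (v j))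
      (fun j => mul_pos (by positivity) (u j).2)
      (fun j => mul_pos (by positivity) (neg_pos.mpr (v j).2)) hm hn
    have hform := negTypeForm_sumElim p (fun j => x (u j)) (fun j => x (v j))
      (fun j => 2 / T * η (u j)) (fun j => 2 / T * -η (v j))
    have hηw : Sum.elim (fun j => 2 / T * η (u j)) (-fun j => 2 / T * -η (v j)) =
        fun i => 2 / T * (η ∘ w) i := by
      ext (j | j) <;> simp [w]
    rw [hxw, hηw, negTypeForm_const_mul, negTypeForm_comp p x η w hw hsupp] at hform
    have hle : (2 / T) ^ 2 * negTypeForm p x η ≤ -(2 * Γ) := by linarith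
    have hmul := mul_le_mul_of_nonneg_left hle (by positivity : 0 ≤ T ^ 2 / 4)
    have hcancel : T ^ 2 / 4 * ((2 / T) ^ 2 * negTypeForm p x η) = negTypeForm p x η := by
      field_simp
      norm_num
    linarith
  · intro h q t hq ht a b hab m n hm hn hm1 hn1
    let e : Fin (q + t) ≃ Fin q ⊕ Fin t := finSumFinEquiv.symm
    have key := h (q + t) (by omega) (Sum.elim a b ∘ e) (hab.comp e.injective)
      (Sum.elim m (-n) ∘ e) (by
        refine (Equiv.sum_comp e (Sum.elim m (-n))).trans ?_
        simp [hm1, hn1])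
    have habs : ∑ l, |(Sum.elim m (-n) ∘ e) l| = 2 := by
      refine (Equiv.sum_comp e fun i => |Sum.elim m (-n) i|).trans ?_
      simp [abs_of_pos (hm _), abs_of_pos (hn _), hm1, hn1]
      norm_num
    have hform : negTypeForm p (Sum.elim a b ∘ e) (Sum.elim m (-n) ∘ e) = _ :=
      (negTypeForm_comp p _ _ e e.injective fun i hi => (hi (e.surjective i)).elim).trans
        (negTypeForm_sumElim p a b m n)
    rw [habs] at key
    change Γ / 2 * 2 ^ 2 + negTypeForm p (Sum.elim a b ∘ e) (Sum.elim m (-n) ∘ e) ≤ 0 at key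
    linarith
end
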